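/- arXiv:1504.04214 — 3 statements merged into one kernel-verified Lean document; each statement's English description precedes it below -/
import Mathlib

section
/- Let f be a mixing piecewise expanding unimodal map with C² branches and let ρ be the density of its unique absolutely continuous invariant probability measure. Then the set of points of [0,1] at which ρ is not differentiable has Hausdorff dimension zero. -/
open MeasureTheory Set Filter Topology Asymptotics
open scoped ENNReal NNReal

/-- `BoundedVariationOn` on the unit interval. -/
def bvOn (φ : ℝ → ℝ) : Prop := BoundedVariationOn φ (Set.Icc 0 1)

/-- The supremum norm of `φ` over `[0,1]`. -/
noncomputable def supNorm (φ : ℝ → ℝ) : ℝ := ⨆ x : Set.Icc (0:ℝ) 1, |φ (x : ℝ)|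

/-- The total variation of `φ` over `[0,1]`, as a real number. -/
noncomputable def var01 (φ : ℝ → ℝ) : ℝ := (eVariationOn φ (Set.Icc 0 1)).toReal

/-- The BV norm `‖φ‖_BV = ‖φ‖_∞ + var(φ)` on `[0,1]`. -/
noncomputable def bvNorm (φ : ℝ → ℝ) : ℝ := supNorm φ + var01 φ

/-- The BV norm with values in `ℝ≥0∞` (no junk values). -/
noncomputable def eBVnorm (φ : ℝ → ℝ) : ℝ≥0∞ :=
  (⨆ x : Set.Icc (0:ℝ) 1, (‖φ (x : ℝ)‖₊ : ℝ≥0∞)) + eVariationOn φ (Set.Icc 0 1)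

/-- The Heaviside-type function `H_a` with value `1` left of `a`, `1/2` at `a`, `0` right of `a`. -/
noncomputable def Hstep (a x : ℝ) : ℝ := if x < a then 1 else if x = a then 1/2 else 0

/-- A piecewise expanding unimodal map (PEUM) of `[0,1]`: a map `f` with critical point
`c ∈ (0,1)` whose two branches `f₁` (on `[0, c+ε]`) and `f₂` (on `[c-ε, 1]`) are `C²` and
satisfy `|Df_j| ≥ λ > 1`. -/
structure PEUM where
  f : ℝ → ℝ
  c : ℝ
  eps : ℝ
  lam : ℝ
  f₁ : ℝ → ℝ
  f₂ : ℝ → ℝ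
  mapsTo : Set.MapsTo f (Set.Icc (0:ℝ) 1) (Set.Icc (0:ℝ) 1)
  c_mem : c ∈ Set.Ioo (0:ℝ) 1
  eps_pos : 0 < eps
  lam_gt_one : 1 < lam
  smooth₁ : ContDiffOn ℝ 2 f₁ (Set.Icc 0 (c + eps))
  smooth₂ : ContDiffOn ℝ 2 f₂ (Set.Icc (c - eps) 1)
  eq₁ : ∀ x ∈ Set.Icc (0:ℝ) 1, x ≤ c → f x = f₁ x
  eq₂ : ∀ x ∈ Set.Icc (0:ℝ) 1, c ≤ x → f x = f₂ x
  branch_eq : f₁ c = f₂ c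
  expand₁ : ∀ x ∈ Set.Icc 0 (c + eps), lam ≤ |deriv f₁ x|
  expand₂ : ∀ x ∈ Set.Icc (c - eps) 1, lam ≤ |deriv f₂ x|

namespace PEUM

/-- Both branches of `P` are of class `C^r`. -/
def BranchSmooth (P : PEUM) (r : ℕ) : Prop :=
  ContDiffOn ℝ r P.f₁ (Set.Icc 0 (P.c + P.eps)) ∧
  ContDiffOn ℝ r P.f₂ (Set.Icc (P.c - P.eps) 1)

/-- The weighted transfer operator `𝓛_m φ(x) = Σ_{f(y)=x} φ(y)/((Df(y))^m |Df(y)|)`,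
the sum ranging over preimages `y ∈ [0,1]` of `x`. -/
noncomputable def transfer (P : PEUM) (m : ℕ) (φ : ℝ → ℝ) : ℝ → ℝ := fun x =>
  ∑' y : {y : ℝ // y ∈ Set.Icc (0:ℝ) 1 ∧ P.f y = x},
    φ y.1 / ((deriv P.f y.1) ^ m * |deriv P.f y.1|)

/-- The Perron–Frobenius operator `𝓛 = 𝓛₀`. -/
noncomputable def PF (P : PEUM) : (ℝ → ℝ) → ℝ → ℝ := P.transfer 0

/-- `ξ(z) = D²f(z)/Df(z)`. -/
noncomputable def xi (P : PEUM) : ℝ → ℝ := fun z => deriv (deriv P.f) z / deriv P.f z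

/-- The measure `ρ dx` on `[0,1]`. -/
noncomputable def invMeasure (P : PEUM) (ρ : ℝ → ℝ) : Measure ℝ :=
  (volume.restrict (Set.Icc (0:ℝ) 1)).withDensity fun x => ENNReal.ofReal (ρ x)

/-- `ρ` is the (BV representative of the) density of the absolutely continuous invariant
probability measure of `P`: it is nonnegative, of bounded variation, `ρ dx` is an
`f`-invariant probability measure, and `𝓛ρ = ρ` on `[0,1]`. -/
def IsInvariantDensity (P : PEUM) (ρ : ℝ → ℝ) : Prop :=
  bvOn ρ ∧ (∀ x, 0 ≤ ρ x) ∧ IsProbabilityMeasure (P.invMeasure ρ) ∧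
    (P.invMeasure ρ).map P.f = P.invMeasure ρ ∧
    ∀ x ∈ Set.Icc (0:ℝ) 1, P.PF ρ x = ρ x

/-- Exponential mixing at rate `θ < 1`:
`𝓛ⁿh = (∫₀¹ h) ρ + O(θⁿ ‖h‖_BV)` for all `h` of bounded variation. -/
def Mixing (P : PEUM) (ρ : ℝ → ℝ) (θ : ℝ) : Prop :=
  0 < θ ∧ θ < 1 ∧ ∃ C : ℝ, 0 < C ∧ ∀ h : ℝ → ℝ, bvOn h → ∀ n : ℕ, ∀ x ∈ Set.Icc (0:ℝ) 1,
    |(P.PF)^[n] h x - (∫ z in Set.Icc (0:ℝ) 1, h z) * ρ x| ≤ C * θ ^ n * bvNorm h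

/-- `ρ₁ = −Σ_{i=1}^∞ 𝓛₁^i(ξ·ρ)` (pointwise sum of the series). -/
noncomputable def rho1 (P : PEUM) (ρ : ℝ → ℝ) : ℝ → ℝ := fun x =>
  -∑' i : ℕ, (P.transfer 1)^[i + 1] (fun y => P.xi y * ρ y) x

/-- The operator `𝔇^{i₁,…,i_k}_{m₁,…,m_k}(h₁,…,h_k)`, encoded on the list
`[(i₁,m₁,h₁),…,(i_k,m_k,h_k)]` by `𝔇((i,m,h) :: rest) = 𝓛_m^i (h · 𝔇(rest))`. -/
noncomputable def DD (P : PEUM) : List (ℕ × ℕ × (ℝ → ℝ)) → ℝ → ℝ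
  | [] => fun _ => 1
  | p :: rest => (P.transfer p.2.1)^[p.1] fun x => p.2.2 x * P.DD rest x

/-- The set `𝒩_β` of points approached exponentially fast (at rate `β`) by the critical
orbit: `|c_n − x| ≤ βⁿ` for infinitely many `n`. -/
def Nbeta (P : PEUM) (β : ℝ) : Set ℝ :=
  {x ∈ Set.Icc (0:ℝ) 1 | ∃ᶠ n in Filter.atTop, |P.f^[n] P.c - x| ≤ β ^ n}

end PEUM
/-- A function approximated by `u n` with error `K * θ ^ n` on a ball of radius `β ^ n` with
`θ < β`, where the derivatives of the `u n` are summably close on these balls, is differentiable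
at the centre. -/
theorem differentiableAt_of_approx_on_shrinking_balls {g : ℝ → ℝ} {u : ℕ → ℝ → ℝ} {a : ℕ → ℝ}
    {x β θ K : ℝ} (hβ : 0 < β) (hβ1 : β < 1) (hθ : 0 ≤ θ) (hθβ : θ < β) (ha : Summable a)
    (hu : ∀ᶠ n in atTop, ∀ y ∈ Metric.closedBall x (β ^ n),
      (∀ k ≤ n, DifferentiableAt ℝ (u k) y) ∧
      (∀ k < n, |deriv (u (k + 1)) y - deriv (u k) y| ≤ a k) ∧ |u n y - g y| ≤ K * θ ^ n) :
    DifferentiableAt ℝ g x := by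
  obtain ⟨n₀, hn₀⟩ := eventually_atTop.1 hu
  have hxmem : ∀ n, x ∈ Metric.closedBall x (β ^ n) := fun n =>
    Metric.mem_closedBall_self (by positivity)
  have hD : ∀ k, dist (deriv (u k) x) (deriv (u (k + 1)) x) ≤ a k := by
    intro k
    rw [dist_comm, Real.dist_eq]
    exact (hn₀ (max n₀ (k + 1)) (le_max_left _ _) x (hxmem _)).2.1 k
      (lt_of_lt_of_le (Nat.lt_succ_self k) (le_max_right _ _))
  have ha0 : ∀ k, 0 ≤ a k := fun k => dist_nonneg.trans (hD k)
  obtain ⟨D, hDlim⟩ := cauchySeq_tendsto_of_complete (cauchySeq_of_dist_le_of_summable a hD ha)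
  have htail : Tendsto (fun m => ∑' k, a (m + k)) atTop (𝓝 0) := by
    simpa only [add_comm] using tendsto_sum_nat_add a
  have hDm : ∀ m, |deriv (u m) x - D| ≤ ∑' k, a (m + k) := fun m => by
    simpa [Real.dist_eq] using dist_le_tsum_of_dist_le_of_tendsto a hD ha hDlim m
  have hdiff : ∀ m n, n₀ ≤ n → m ≤ n → ∀ y ∈ Metric.closedBall x (β ^ n),
      |deriv (u n - u m) y| ≤ ∑' k, a (m + k) := by
    intro m n hn hmn y hy
    obtain ⟨h1, h2, -⟩ := hn₀ n hn y hy
    rw [deriv_sub (h1 n le_rfl) (h1 m hmn), abs_sub_comm, ← Real.dist_eq]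
    refine (dist_le_Ico_sum_of_dist_le (f := fun k => deriv (u k) y) (d := a) hmn
      fun {k} _ hk => ?_).trans ?_
    · rw [dist_comm, Real.dist_eq]
      exact h2 k hk
    · rw [Finset.sum_Ico_eq_sum_range]
      exact Summable.sum_le_tsum _ (fun i _ => ha0 _)
        (by simpa only [add_comm] using (summable_nat_add_iff m).2 ha)
  have hderiv : HasDerivAt g D x := by
    rw [hasDerivAt_iff_isLittleO, Asymptotics.isLittleO_iff]
    intro c hc
    obtain ⟨m, hm⟩ := (htail.eventually (gt_mem_nhds (show 0 < c / 4 by positivity))).exists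
    have hum : ∀ᶠ y in 𝓝 x, ‖u m y - u m x - (y - x) • deriv (u m) x‖ ≤ c / 4 * ‖y - x‖ := by
      have := ((hn₀ (max n₀ m) (le_max_left _ _) x (hxmem _)).1 m
        (le_max_right _ _)).hasDerivAt
      rw [hasDerivAt_iff_isLittleO, Asymptotics.isLittleO_iff] at this
      exact this (by positivity)
    have hsmall : ∀ᶠ n in atTop, 2 * K * (θ / β) ^ n ≤ c / 4 * β := by
      have : Tendsto (fun n : ℕ => 2 * K * (θ / β) ^ n) atTop (𝓝 (2 * K * 0)) :=
        (tendsto_pow_atTop_nhds_zero_of_lt_one (by positivity)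
          ((div_lt_one hβ).2 hθβ)).const_mul _
      rw [mul_zero] at this
      exact (this.eventually (gt_mem_nhds (show 0 < c / 4 * β by positivity))).mono
        fun _ h => le_of_lt h
    obtain ⟨n₁, hn₁⟩ := eventually_atTop.1 hsmall
    set N := max (max n₀ m) n₁ with hN
    filter_upwards [hum, Metric.ball_mem_nhds x (pow_pos hβ N)] with y hy hyN
    rw [Metric.mem_ball, Real.dist_eq] at hyN
    rcases eq_or_ne y x with rfl | hyx
    · simp
    have hpos : 0 < |y - x| := abs_pos.2 (sub_ne_zero.2 hyx)
    obtain ⟨n, hn1, hn2⟩ := exists_nat_pow_near_of_lt_one hpos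
      (hyN.le.trans (pow_le_one₀ hβ.le hβ1.le)) hβ hβ1
    have hNn : N ≤ n := by
      by_contra! h
      exact absurd (hn1.trans hyN)
        (not_lt.2 (pow_le_pow_of_le_one hβ.le hβ1.le h))
    have hnn₀ : n₀ ≤ n := (le_max_left _ _).trans ((le_max_left _ _).trans hNn)
    have hnm : m ≤ n := (le_max_right _ _).trans ((le_max_left _ _).trans hNn)
    have hnn₁ : n₁ ≤ n := (le_max_right _ _).trans hNn
    have hymem : y ∈ Metric.closedBall x (β ^ n) := by
      rwa [Metric.mem_closedBall, Real.dist_eq]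
    have e1 := (hn₀ n hnn₀ y hymem).2.2
    have e2 := (hn₀ n hnn₀ x (hxmem n)).2.2
    have e3 : |(u n - u m) y - (u n - u m) x| ≤ (∑' k, a (m + k)) * |y - x| :=
      Convex.norm_image_sub_le_of_norm_deriv_le
        (fun z hz => ((hn₀ n hnn₀ z hz).1 n le_rfl).sub ((hn₀ n hnn₀ z hz).1 m hnm))
        (hdiff m n hnn₀ hnm) (convex_closedBall x _) (hxmem n) hymem
    have e4 : |(y - x) * (deriv (u m) x - D)| ≤ (∑' k, a (m + k)) * |y - x| := by
      rw [abs_mul, mul_comm]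
      exact mul_le_mul_of_nonneg_right (hDm m) (abs_nonneg _)
    have e5 : 2 * (K * θ ^ n) ≤ c / 4 * |y - x| := by
      have h := mul_le_mul_of_nonneg_right (hn₁ n hnn₁) (pow_pos hβ n).le
      have h' : 2 * K * (θ / β) ^ n * β ^ n = 2 * (K * θ ^ n) := by
        rw [div_pow]; field_simp
      rw [h'] at h
      refine h.trans ?_
      rw [mul_assoc, ← pow_succ']
      gcongr
    have e6 : (∑' k, a (m + k)) * |y - x| ≤ c / 4 * |y - x| := by gcongr
    simp only [Real.norm_eq_abs, smul_eq_mul, Pi.sub_apply] at *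
    rw [abs_le] at *
    constructor <;> nlinarith
  exact hderiv.differentiableAt

/-- The set of points approached infinitely often at an exponential rate by a given sequence has
Hausdorff dimension zero. -/
theorem dimH_limsup_exponential_approach_eq_zero (z : ℕ → ℝ) {β : ℝ} (hβ : 0 < β) (hβ1 : β < 1) :
    dimH {x : ℝ | ∃ᶠ n in atTop, |z n - x| ≤ β ^ n} = 0 := by
  have key : ∀ s : ℝ≥0, 0 < s → dimH {x : ℝ | ∃ᶠ n in atTop, |z n - x| ≤ β ^ n} ≤ s := by
    intro s hs
    apply dimH_le_of_hausdorffMeasure_ne_top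
    have hs' : (0:ℝ) < s := by exact_mod_cast hs
    set q : ℝ≥0∞ := ENNReal.ofReal β with hq
    have hq1 : q < 1 := by rw [hq]; exact ENNReal.ofReal_lt_one.2 hβ1
    have hqs : q ^ (s:ℝ) < 1 := ENNReal.rpow_lt_one hq1 hs'
    have hdiam : ∀ k : ℕ, Metric.ediam (Metric.closedBall (z k) (β ^ k)) ≤ 2 * q ^ k := by
      intro k
      rw [Real.closedBall_eq_Icc, Real.ediam_Icc, hq, ← ENNReal.ofReal_pow hβ.le]
      rw [show z k + β ^ k - (z k - β ^ k) = 2 * β ^ k by ring, ENNReal.ofReal_mul (by norm_num)]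
      simp
    have hle := Measure.hausdorffMeasure_le_liminf_tsum (X := ℝ) (s : ℝ)
      {x : ℝ | ∃ᶠ n in atTop, |z n - x| ≤ β ^ n} (l := atTop) (fun N : ℕ => 2 * q ^ N)
      (by
        have := ENNReal.Tendsto.const_mul (a := 2) (ENNReal.tendsto_pow_atTop_nhds_zero_of_lt_one hq1)
          (Or.inr (by norm_num))
        simpa using this)
      (fun N k => Metric.closedBall (z (N + k)) (β ^ (N + k)))
      (Eventually.of_forall fun N k => (hdiam _).trans (by
        gcongr 2 * ?_
        exact pow_le_pow_right_of_le_one' hq1.le (Nat.le_add_right N k)))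
      (Eventually.of_forall fun N x hx => by
        obtain ⟨n, hn, hxn⟩ := (frequently_atTop.1 hx) N
        refine mem_iUnion.2 ⟨n - N, ?_⟩
        rw [Nat.add_sub_cancel' hn, Metric.mem_closedBall, dist_comm, Real.dist_eq]
        exact hxn)
    refine ne_top_of_le_ne_top ?_ (hle.trans (liminf_le_of_le
      (a := 2 ^ (s:ℝ) * (1 - q ^ (s:ℝ))⁻¹) (by isBoundedDefault) ?_))
    · refine ENNReal.mul_ne_top (ENNReal.rpow_ne_top_of_nonneg hs'.le (by norm_num)) ?_
      exact ENNReal.inv_ne_top.2 (tsub_pos_of_lt hqs).ne'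
    · intro b hb
      obtain ⟨N, hN⟩ := hb.exists
      refine hN.trans ?_
      rw [← ENNReal.tsum_geometric, ← ENNReal.tsum_mul_left]
      refine ENNReal.tsum_le_tsum fun k => ?_
      calc _ ≤ (2 * q ^ k) ^ (s:ℝ) := by
            refine ENNReal.rpow_le_rpow ((hdiam _).trans ?_) hs'.le
            gcongr 2 * ?_
            exact pow_le_pow_right_of_le_one' hq1.le (Nat.le_add_left k N)
        _ = 2 ^ (s:ℝ) * (q ^ (s:ℝ)) ^ k := by
            rw [ENNReal.mul_rpow_of_nonneg _ _ hs'.le, ← ENNReal.rpow_natCast,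
              ← ENNReal.rpow_natCast, ← ENNReal.rpow_mul, ← ENNReal.rpow_mul, mul_comm (k:ℝ)]
  refine le_antisymm (le_of_forall_gt fun r hr => ?_) bot_le
  obtain ⟨s, hs0, hsr⟩ := ENNReal.lt_iff_exists_nnreal_btwn.1 hr
  exact (key s (by exact_mod_cast hs0)).trans_lt hsr

/-- The sum of `ψ / |g'|` over the preimages of `x` under `g` in the open interval `(a, b)`. -/
noncomputable def branchSum (g : ℝ → ℝ) (a b : ℝ) (ψ : ℝ → ℝ) (x : ℝ) : ℝ :=
  ∑' y : {y : ℝ // y ∈ Ioo a b ∧ g y = x}, ψ y.1 / |deriv g y.1|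

theorem branchSum_eq {g : ℝ → ℝ} {a b y : ℝ} (hinj : InjOn g (Ioo a b)) (hy : y ∈ Ioo a b)
    (ψ : ℝ → ℝ) : branchSum g a b ψ (g y) = ψ y / |deriv g y| := by
  unfold branchSum
  rw [tsum_eq_single (⟨y, hy, rfl⟩ : {z : ℝ // z ∈ Ioo a b ∧ g z = g y})]
  rintro ⟨z, hz, hzy⟩ hne
  exact absurd (Subtype.ext (hinj hz hy hzy)) hne

theorem branchSum_eq_zero {g : ℝ → ℝ} {a b x : ℝ} (hx : ∀ y ∈ Ioo a b, g y ≠ x) (ψ : ℝ → ℝ) :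
    branchSum g a b ψ x = 0 := by
  unfold branchSum
  have : IsEmpty {y : ℝ // y ∈ Ioo a b ∧ g y = x} := ⟨fun y => hx y.1 y.2.1 y.2.2⟩
  exact tsum_empty

theorem exists_hasDerivAt_branchSum {g φ : ℝ → ℝ} {a b lam A x : ℝ} (hlam : 1 < lam)
    (hcont : ContinuousOn g (Icc a b)) (hinj : InjOn g (Ioo a b))
    (hsm : ∀ y ∈ Ioo a b, ContDiffAt ℝ 2 g y) (hexp : ∀ y ∈ Ioo a b, lam ≤ |deriv g y|)
    (hA : ∀ y ∈ Ioo a b, |deriv (deriv g) y| ≤ A) (hxa : g a ≠ x) (hxb : g b ≠ x)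
    (hφ : ∀ y ∈ Ioo a b, g y = x → DifferentiableAt ℝ φ y) :
    ∃ d, HasDerivAt (branchSum g a b φ) d x ∧
      |d| ≤ branchSum g a b (fun y => |deriv φ y| / lam + A * |φ y|) x := by
  by_cases hx : ∃ y ∈ Ioo a b, g y = x
  · obtain ⟨y, hy, rfl⟩ := hx
    have hp : deriv g y ≠ 0 := abs_pos.1 (by linarith [hexp y hy])
    have hg : HasStrictDerivAt g (deriv g y) y := (hsm y hy).hasStrictDerivAt (by norm_num)
    have hg' : DifferentiableAt ℝ (deriv g) y := by
      have h : ContDiffAt ℝ 1 (fderiv ℝ g) y := (hsm y hy).fderiv_right (by norm_num)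
      exact (h.differentiableAt (by norm_num)).clm_apply (differentiableAt_const (1 : ℝ))
    have habs : HasDerivAt (fun z => |deriv g z|) (SignType.sign (deriv g y) * deriv (deriv g) y) y :=
      (hasDerivAt_abs hp).comp y hg'.hasDerivAt
    have hW := (hφ y hy rfl).hasDerivAt.div habs (abs_ne_zero.2 hp)
    set ℓ := hg.localInverse g (deriv g y) y hp with hℓ
    have hℓd : HasDerivAt ℓ (deriv g y)⁻¹ (g y) := (hg.to_localInverse hp).hasDerivAt
    have hℓy : ℓ (g y) = y := HasStrictFDerivAt.localInverse_apply_image _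
    rw [← hℓy] at hW
    have hcomp := hW.comp (g y) hℓd
    rw [hℓy] at hcomp
    refine ⟨_, hcomp.congr_of_eventuallyEq ?_, ?_⟩
    · have hmem : ∀ᶠ z in 𝓝 (g y), ℓ z ∈ Ioo a b :=
        hℓd.continuousAt.eventually (by rw [hℓy]; exact isOpen_Ioo.mem_nhds hy)
      filter_upwards [hmem, hg.eventually_right_inverse hp] with z hz1 hz2
      have h := branchSum_eq hinj hz1 φ
      rw [hz2] at h
      exact h
    · rw [branchSum_eq hinj hy]
      set p := deriv g y with hpdef
      have hpl : lam ≤ |p| := hexp y hy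
      have hp0 : 0 < |p| := by linarith
      have hA0 : |deriv (deriv g) y| ≤ A := hA y hy
      have hsign : |((SignType.sign p : SignType) : ℝ)| ≤ 1 := by
        rcases lt_or_gt_of_ne hp with h | h <;> simp [h]
      rw [abs_mul, abs_div, abs_inv, abs_pow, abs_abs]
      have h1 : |deriv φ y * |p| - φ y * (SignType.sign p * deriv (deriv g) y)| ≤
          |deriv φ y| * |p| + A * |φ y| := by
        refine (abs_sub _ _).trans (add_le_add (by rw [abs_mul, abs_abs]) ?_)
        rw [abs_mul, abs_mul, mul_comm A]
        gcongr
        calc _ ≤ 1 * A := by gcongr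
          _ = A := one_mul A
      calc _ ≤ (|deriv φ y| * |p| + A * |φ y|) / |p| ^ 2 * |p|⁻¹ := by gcongr
        _ = (|deriv φ y| / |p| + A * |φ y| / |p| ^ 2) / |p| := by field_simp
        _ ≤ _ := by
          have hA' : 0 ≤ A := (abs_nonneg _).trans hA0
          gcongr
          exact div_le_self (by positivity) (one_le_pow₀ (by linarith))
  · push Not at hx
    refine ⟨0, ?_, by rw [branchSum_eq_zero hx, abs_zero]⟩
    have hclosed : IsClosed (g '' Icc a b) := (isCompact_Icc.image_of_continuousOn hcont).isClosed
    have hxn : x ∉ g '' Icc a b := by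
      rintro ⟨y, hy, hyx⟩
      rcases eq_or_lt_of_le hy.1 with h | h
      · exact hxa (h ▸ hyx)
      rcases eq_or_lt_of_le hy.2 with h' | h'
      · exact hxb (h' ▸ hyx)
      exact hx y ⟨h, h'⟩ hyx
    refine (hasDerivAt_const x (0:ℝ)).congr_of_eventuallyEq ?_
    filter_upwards [hclosed.isOpen_compl.mem_nhds hxn] with z hz
    exact branchSum_eq_zero (fun y hy hyz => hz ⟨y, Ioo_subset_Icc_self hy, hyz⟩) φ

namespace PEUM

variable (P : PEUM)

theorem f_eventuallyEq_left {y : ℝ} (hy : y ∈ Ioo 0 P.c) : P.f =ᶠ[𝓝 y] P.f₁ := by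
  filter_upwards [isOpen_Ioo.mem_nhds hy] with z hz
  exact P.eq₁ z ⟨hz.1.le, hz.2.le.trans P.c_mem.2.le⟩ hz.2.le

theorem f_eventuallyEq_right {y : ℝ} (hy : y ∈ Ioo P.c 1) : P.f =ᶠ[𝓝 y] P.f₂ := by
  filter_upwards [isOpen_Ioo.mem_nhds hy] with z hz
  exact P.eq₂ z ⟨P.c_mem.1.le.trans hz.1.le, hz.2.le⟩ hz.1.le

theorem contDiffAt_left {y : ℝ} (hy : y ∈ Ioo 0 P.c) : ContDiffAt ℝ 2 P.f₁ y :=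
  P.smooth₁.contDiffAt (Icc_mem_nhds hy.1 (by linarith [hy.2, P.eps_pos]))

theorem contDiffAt_right {y : ℝ} (hy : y ∈ Ioo P.c 1) : ContDiffAt ℝ 2 P.f₂ y :=
  P.smooth₂.contDiffAt (Icc_mem_nhds (by linarith [hy.1, P.eps_pos]) hy.2)

theorem contDiffAt_f {y : ℝ} (hy : y ∈ Ioo 0 P.c ∨ y ∈ Ioo P.c 1) : ContDiffAt ℝ 2 P.f y := by
  rcases hy with hy | hy
  · exact (P.contDiffAt_left hy).congr_of_eventuallyEq (P.f_eventuallyEq_left hy)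
  · exact (P.contDiffAt_right hy).congr_of_eventuallyEq (P.f_eventuallyEq_right hy)

theorem lam_le_abs_deriv {y : ℝ} (hy : y ∈ Ioo 0 P.c ∨ y ∈ Ioo P.c 1) :
    P.lam ≤ |deriv P.f y| := by
  rcases hy with hy | hy
  · rw [(P.f_eventuallyEq_left hy).deriv_eq]
    exact P.expand₁ y ⟨hy.1.le, by linarith [hy.2, P.eps_pos]⟩
  · rw [(P.f_eventuallyEq_right hy).deriv_eq]
    exact P.expand₂ y ⟨by linarith [hy.1, P.eps_pos], hy.2.le⟩

/-- The second derivative of a function that is `C²` on a compact interval is bounded on the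
interior of that interval. -/
theorem _root_.ContDiffOn.exists_abs_deriv_deriv_le {g : ℝ → ℝ} {a b : ℝ} (hab : a < b)
    (hg : ContDiffOn ℝ 2 g (Icc a b)) : ∃ A, ∀ y ∈ Ioo a b, |deriv (deriv g) y| ≤ A := by
  obtain ⟨A, hA⟩ := isCompact_Icc.exists_bound_of_continuousOn
    (hg.continuousOn_iteratedDerivWithin (m := 2) (by norm_num) (uniqueDiffOn_Icc hab))
  refine ⟨A, fun y hy => ?_⟩
  have h := hA y (Ioo_subset_Icc_self hy)
  rwa [iteratedDerivWithin_eq_iteratedDeriv (uniqueDiffOn_Icc hab)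
    (hg.contDiffAt (Icc_mem_nhds hy.1 hy.2)) (Ioo_subset_Icc_self hy), iteratedDeriv_succ,
    iteratedDeriv_one, Real.norm_eq_abs] at h

theorem exists_abs_deriv_deriv_le :
    ∃ A, 0 ≤ A ∧ ∀ y, (y ∈ Ioo 0 P.c ∨ y ∈ Ioo P.c 1) → |deriv (deriv P.f) y| ≤ A := by
  have hc := P.c_mem
  have he := P.eps_pos
  obtain ⟨A₁, h₁⟩ := P.smooth₁.exists_abs_deriv_deriv_le (by linarith [hc.1])
  obtain ⟨A₂, h₂⟩ := P.smooth₂.exists_abs_deriv_deriv_le (by linarith [hc.2])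
  refine ⟨max 0 (max A₁ A₂), le_max_left _ _, ?_⟩
  rintro y (hy | hy)
  · rw [(P.f_eventuallyEq_left hy).deriv.deriv_eq]
    exact (h₁ y ⟨hy.1, by linarith [hy.2]⟩).trans ((le_max_left _ _).trans (le_max_right _ _))
  · rw [(P.f_eventuallyEq_right hy).deriv.deriv_eq]
    exact (h₂ y ⟨by linarith [hy.1], hy.2⟩).trans ((le_max_right _ _).trans (le_max_right _ _))

theorem continuousOn_left : ContinuousOn P.f (Icc 0 P.c) := by
  refine (P.smooth₁.continuousOn.mono (Icc_subset_Icc_right (by linarith [P.eps_pos]))).congr ?_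
  exact fun y hy => P.eq₁ y ⟨hy.1, hy.2.trans P.c_mem.2.le⟩ hy.2

theorem continuousOn_right : ContinuousOn P.f (Icc P.c 1) := by
  refine (P.smooth₂.continuousOn.mono (Icc_subset_Icc_left (by linarith [P.eps_pos]))).congr ?_
  exact fun y hy => P.eq₂ y ⟨P.c_mem.1.le.trans hy.1, hy.2⟩ hy.1

/-- A continuous function with nonvanishing derivative inside an interval is injective there. -/
theorem _root_.ContinuousOn.injOn_of_deriv_ne_zero {g : ℝ → ℝ} {a b : ℝ}
    (hcont : ContinuousOn g (Icc a b)) (hg : ∀ y ∈ Ioo a b, deriv g y ≠ 0) :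
    InjOn g (Icc a b) := by
  have key : ∀ y ∈ Icc a b, ∀ z ∈ Icc a b, y < z → g y ≠ g z := by
    intro y hy z hz hyz h
    obtain ⟨w, hw, hw0⟩ := exists_deriv_eq_zero hyz (hcont.mono (Icc_subset_Icc hy.1 hz.2)) h
    exact hg w ⟨hy.1.trans_lt hw.1, hw.2.trans_le hz.2⟩ hw0
  intro y hy z hz h
  rcases lt_trichotomy y z with hlt | heq | hlt
  · exact absurd h (key y hy z hz hlt)
  · exact heq
  · exact absurd h.symm (key z hz y hy hlt)

theorem deriv_f_ne_zero {y : ℝ} (hy : y ∈ Ioo 0 P.c ∨ y ∈ Ioo P.c 1) : deriv P.f y ≠ 0 :=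
  abs_pos.1 (by linarith [P.lam_le_abs_deriv hy, P.lam_gt_one])

theorem injOn_left : InjOn P.f (Icc 0 P.c) :=
  P.continuousOn_left.injOn_of_deriv_ne_zero fun _ hy => P.deriv_f_ne_zero (Or.inl hy)

theorem injOn_right : InjOn P.f (Icc P.c 1) :=
  P.continuousOn_right.injOn_of_deriv_ne_zero fun _ hy => P.deriv_f_ne_zero (Or.inr hy)

theorem finite_fiber (x : ℝ) : {y : ℝ | y ∈ Icc (0:ℝ) 1 ∧ P.f y = x}.Finite := by
  have h₁ : {y : ℝ | y ∈ Icc 0 P.c ∧ P.f y = x}.Subsingleton := fun y hy z hz =>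
    P.injOn_left hy.1 hz.1 (hy.2.trans hz.2.symm)
  have h₂ : {y : ℝ | y ∈ Icc P.c 1 ∧ P.f y = x}.Subsingleton := fun y hy z hz =>
    P.injOn_right hy.1 hz.1 (hy.2.trans hz.2.symm)
  refine (h₁.finite.union h₂.finite).subset ?_
  rintro y ⟨hy, hyx⟩
  rcases le_total y P.c with h | h
  · exact Or.inl ⟨⟨hy.1, h⟩, hyx⟩
  · exact Or.inr ⟨⟨h, hy.2⟩, hyx⟩

instance finite_fiber_subtype (x : ℝ) : Finite {y : ℝ // y ∈ Icc (0:ℝ) 1 ∧ P.f y = x} :=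
  P.finite_fiber x

theorem PF_apply (φ : ℝ → ℝ) (x : ℝ) :
    P.PF φ x = ∑' y : {y : ℝ // y ∈ Icc (0:ℝ) 1 ∧ P.f y = x}, φ y.1 / |deriv P.f y.1| := by
  simp [PF, transfer]

theorem PF_mono {φ ψ : ℝ → ℝ} {x : ℝ} (h : ∀ y ∈ Icc (0:ℝ) 1, P.f y = x → φ y ≤ ψ y) :
    P.PF φ x ≤ P.PF ψ x := by
  rw [PF_apply, PF_apply]
  refine Summable.tsum_le_tsum (fun y => ?_) Summable.of_finite Summable.of_finite
  gcongr
  exact h y.1 y.2.1 y.2.2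

theorem isLinearMap_PF : IsLinearMap ℝ P.PF where
  map_add φ ψ := by
    funext x
    rw [Pi.add_apply, PF_apply, PF_apply, PF_apply,
      ← Summable.tsum_add Summable.of_finite Summable.of_finite]
    simp only [Pi.add_apply, add_div]
  map_smul r φ := by
    funext x
    rw [Pi.smul_apply, PF_apply, PF_apply, smul_eq_mul, ← tsum_mul_left]
    simp only [Pi.smul_apply, smul_eq_mul, mul_div_assoc]

theorem PF_eq_branchSum_add {x : ℝ} (h0 : P.f 0 ≠ x) (hc : P.f P.c ≠ x) (h1 : P.f 1 ≠ x)
    (φ : ℝ → ℝ) :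
    P.PF φ x = branchSum P.f 0 P.c φ x + branchSum P.f P.c 1 φ x := by
  have hc' := P.c_mem
  have hset : {y : ℝ | y ∈ Icc (0:ℝ) 1 ∧ P.f y = x} =
      {y : ℝ | y ∈ Ioo 0 P.c ∧ P.f y = x} ∪ {y : ℝ | y ∈ Ioo P.c 1 ∧ P.f y = x} := by
    ext y
    constructor
    · rintro ⟨hy, hyx⟩
      have hy0 : 0 ≠ y := fun h => h0 (h ▸ hyx)
      have hy1 : y ≠ 1 := fun h => h1 (h ▸ hyx)
      rcases lt_trichotomy y P.c with h | h | h
      · exact Or.inl ⟨⟨lt_of_le_of_ne hy.1 hy0, h⟩, hyx⟩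
      · exact absurd (h ▸ hyx) hc
      · exact Or.inr ⟨⟨h, lt_of_le_of_ne hy.2 hy1⟩, hyx⟩
    · rintro (⟨hy, hyx⟩ | ⟨hy, hyx⟩)
      · exact ⟨⟨hy.1.le, hy.2.le.trans hc'.2.le⟩, hyx⟩
      · exact ⟨⟨hc'.1.le.trans hy.1.le, hy.2.le⟩, hyx⟩
  have hfin := P.finite_fiber x
  rw [hset] at hfin
  have hf₁ := (hfin.subset subset_union_left).to_subtype
  have hf₂ := (hfin.subset subset_union_right).to_subtype
  have hdisj : Disjoint {y : ℝ | y ∈ Ioo 0 P.c ∧ P.f y = x}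
      {y : ℝ | y ∈ Ioo P.c 1 ∧ P.f y = x} :=
    disjoint_left.2 fun y hy hy' => lt_asymm hy.1.2 hy'.1.1
  have h := Summable.tsum_union_disjoint (f := fun y => φ y / |deriv P.f y|) hdisj
    Summable.of_finite Summable.of_finite
  rw [← hset] at h
  rw [PF_apply]
  exact h

/-- Away from the images of `0`, `c` and `1`, the transfer operator preserves
differentiability, with control on the derivative. -/
theorem exists_hasDerivAt_PF {A : ℝ}
    (hA : ∀ y, (y ∈ Ioo 0 P.c ∨ y ∈ Ioo P.c 1) → |deriv (deriv P.f) y| ≤ A) {φ : ℝ → ℝ} {x : ℝ}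
    (h0 : P.f 0 ≠ x) (hc : P.f P.c ≠ x) (h1 : P.f 1 ≠ x)
    (hφ : ∀ y ∈ Icc (0:ℝ) 1, P.f y = x → DifferentiableAt ℝ φ y) :
    ∃ d, HasDerivAt (P.PF φ) d x ∧
      |d| ≤ P.PF (fun y => |deriv φ y| / P.lam + A * |φ y|) x := by
  have hc' := P.c_mem
  obtain ⟨d₁, hd₁, hb₁⟩ := exists_hasDerivAt_branchSum (φ := φ) P.lam_gt_one P.continuousOn_left
    (P.injOn_left.mono Ioo_subset_Icc_self) (fun y hy => P.contDiffAt_f (Or.inl hy))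
    (fun y hy => P.lam_le_abs_deriv (Or.inl hy)) (fun y hy => hA y (Or.inl hy)) h0 hc
    (fun y hy => hφ y ⟨hy.1.le, hy.2.le.trans hc'.2.le⟩)
  obtain ⟨d₂, hd₂, hb₂⟩ := exists_hasDerivAt_branchSum (φ := φ) P.lam_gt_one P.continuousOn_right
    (P.injOn_right.mono Ioo_subset_Icc_self) (fun y hy => P.contDiffAt_f (Or.inr hy))
    (fun y hy => P.lam_le_abs_deriv (Or.inr hy)) (fun y hy => hA y (Or.inr hy)) hc h1
    (fun y hy => hφ y ⟨hc'.1.le.trans hy.1.le, hy.2.le⟩)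
  refine ⟨d₁ + d₂, (hd₁.add hd₂).congr_of_eventuallyEq ?_, ?_⟩
  · filter_upwards [isOpen_ne.mem_nhds h0.symm, isOpen_ne.mem_nhds hc.symm,
      isOpen_ne.mem_nhds h1.symm] with z hz0 hzc hz1
    exact P.PF_eq_branchSum_add hz0.symm hzc.symm hz1.symm φ
  · rw [P.PF_eq_branchSum_add h0 hc h1]
    exact (abs_add_le _ _).trans (add_le_add hb₁ hb₂)

/-- The points of the forward orbits of `0`, `c` and `1` at times `1, …, n`. -/
def singularOrbit (n : ℕ) : Set ℝ :=
  {y | ∃ a ∈ ({0, P.c, 1} : Set ℝ), ∃ k < n, P.f^[k + 1] a = y}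

theorem singularOrbit_mono {m n : ℕ} (h : m ≤ n) : P.singularOrbit m ⊆ P.singularOrbit n := by
  rintro y ⟨a, ha, k, hk, rfl⟩
  exact ⟨a, ha, k, hk.trans_le h, rfl⟩

theorem f_ne_of_notMem_singularOrbit {n : ℕ} {x a : ℝ} (hx : x ∉ P.singularOrbit (n + 1))
    (ha : a ∈ ({0, P.c, 1} : Set ℝ)) : P.f a ≠ x := fun h =>
  hx ⟨a, ha, 0, Nat.succ_pos n, h⟩

theorem notMem_singularOrbit_of_image {n : ℕ} {y : ℝ} (h : P.f y ∉ P.singularOrbit (n + 1)) :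
    y ∉ P.singularOrbit n := by
  rintro ⟨a, ha, k, hk, rfl⟩
  exact h ⟨a, ha, k + 1, Nat.succ_lt_succ hk, Function.iterate_succ_apply' _ _ _⟩

/-- The iterates `𝓛ⁿ 1`. -/
noncomputable def iterOne (n : ℕ) : ℝ → ℝ := P.PF^[n] fun _ => 1

theorem iterOne_succ (n : ℕ) : P.iterOne (n + 1) = P.PF (P.iterOne n) :=
  Function.iterate_succ_apply' _ _ _

theorem differentiableAt_iterOne (n : ℕ) {x : ℝ} (hx : x ∉ P.singularOrbit n) :
    DifferentiableAt ℝ (P.iterOne n) x := by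
  obtain ⟨A, -, hA⟩ := P.exists_abs_deriv_deriv_le
  induction n generalizing x with
  | zero => exact differentiableAt_const _
  | succ n ih =>
    rw [iterOne_succ]
    obtain ⟨d, hd, -⟩ := P.exists_hasDerivAt_PF hA
      (P.f_ne_of_notMem_singularOrbit hx (by simp)) (P.f_ne_of_notMem_singularOrbit hx (by simp))
      (P.f_ne_of_notMem_singularOrbit hx (by simp)) (φ := P.iterOne n)
      (fun y _ hyx => ih (P.notMem_singularOrbit_of_image (by rwa [hyx])))
    exact hd.differentiableAt

/-- `𝓛ⁿ 1 + ∑ 𝓛ⁱ 1` over `1 ≤ i ≤ n`, which up to a factor dominates the derivative of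
`𝓛ⁿ⁺¹ 1 - 𝓛ⁿ 1`. -/
noncomputable def iterSum (n : ℕ) : ℝ → ℝ :=
  P.iterOne n + ∑ i ∈ Finset.range n, P.iterOne (i + 1)

theorem iterSum_succ (n : ℕ) : P.iterSum (n + 1) = P.PF (P.iterSum n + fun _ => 1) := by
  have h := map_add (IsLinearMap.mk' P.PF P.isLinearMap_PF) (P.iterSum n) (fun _ => 1)
  simp only [IsLinearMap.mk'_apply] at h
  rw [h, iterSum, iterSum, ← IsLinearMap.mk'_apply P.isLinearMap_PF (_ + _), map_add, map_sum]
  simp only [IsLinearMap.mk'_apply, ← iterOne_succ]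
  rw [Finset.sum_range_succ', add_assoc]
  rfl

theorem PF_nonneg {φ : ℝ → ℝ} (h : ∀ y, 0 ≤ φ y) (x : ℝ) : 0 ≤ P.PF φ x := by
  rw [PF_apply]
  exact tsum_nonneg fun y => div_nonneg (h _) (abs_nonneg _)

theorem iterOne_nonneg (n : ℕ) (x : ℝ) : 0 ≤ P.iterOne n x := by
  induction n generalizing x with
  | zero => exact zero_le_one
  | succ n ih => rw [iterOne_succ]; exact P.PF_nonneg ih x

theorem iterSum_nonneg (n : ℕ) (x : ℝ) : 0 ≤ P.iterSum n x := by
  simp only [iterSum, Pi.add_apply, Finset.sum_apply]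
  exact add_nonneg (P.iterOne_nonneg n x) (Finset.sum_nonneg fun i _ => P.iterOne_nonneg _ x)

theorem abs_deriv_iterOne_succ_sub_le {A B K G θ η : ℝ}
    (hA0 : 0 ≤ A) (hA : ∀ y, (y ∈ Ioo 0 P.c ∨ y ∈ Ioo P.c 1) → |deriv (deriv P.f) y| ≤ A)
    (hB : ∀ n, ∀ x ∈ Icc (0:ℝ) 1, |P.iterOne (n + 1) x - P.iterOne n x| ≤ B * θ ^ n)
    (hB0 : 0 ≤ B) (hθ : 0 ≤ θ) (hθη : θ ≤ η) (hlη : P.lam⁻¹ ≤ η)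
    (hK : ∀ x ∈ Icc (0:ℝ) 1, P.iterOne 1 x ≤ K) (hGK : A * K ≤ G) (hGB : A * B ≤ G * η)
    (hG : 0 ≤ G) (n : ℕ) {x : ℝ} (hx01 : x ∈ Icc (0:ℝ) 1) (hx : x ∉ P.singularOrbit (n + 1)) :
    |deriv (P.iterOne (n + 1) - P.iterOne n) x| ≤ G * η ^ n * P.iterSum n x := by
  induction n generalizing x with
  | zero =>
    obtain ⟨d, hd, hdb⟩ := P.exists_hasDerivAt_PF hA
      (P.f_ne_of_notMem_singularOrbit hx (by simp)) (P.f_ne_of_notMem_singularOrbit hx (by simp))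
      (P.f_ne_of_notMem_singularOrbit hx (by simp)) (φ := fun _ => 1)
      (fun y _ hyx => differentiableAt_const _)
    have hderiv : deriv (P.iterOne (0 + 1) - P.iterOne 0) x = d := by
      have := hd.sub (hasDerivAt_const x (1:ℝ))
      rw [sub_zero] at this
      exact this.deriv
    have hs : P.PF (fun y => |deriv (fun _ : ℝ => (1:ℝ)) y| / P.lam + A * |(1:ℝ)|) x =
        A * P.iterOne 1 x := by
      have := congrFun (P.isLinearMap_PF.map_smul A fun _ => 1) x
      simp only [deriv_const, abs_zero, zero_div, zero_add, abs_one, mul_one]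
      simpa [Pi.smul_def, iterOne] using this
    rw [hderiv]
    rw [hs] at hdb
    refine hdb.trans ?_
    simpa [iterSum, iterOne] using (mul_le_mul_of_nonneg_left (hK x hx01) hA0).trans hGK
  | succ n ih =>
    have hsub : P.iterOne (n + 1 + 1) - P.iterOne (n + 1) =
        P.PF (P.iterOne (n + 1) - P.iterOne n) := by
      rw [P.isLinearMap_PF.map_sub, ← iterOne_succ, ← iterOne_succ]
    have hmem : ∀ y, P.f y = x → y ∉ P.singularOrbit (n + 1) := fun y hyx =>
      P.notMem_singularOrbit_of_image (by rwa [hyx])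
    obtain ⟨d, hd, hdb⟩ := P.exists_hasDerivAt_PF hA
      (P.f_ne_of_notMem_singularOrbit hx (by simp)) (P.f_ne_of_notMem_singularOrbit hx (by simp))
      (P.f_ne_of_notMem_singularOrbit hx (by simp)) (φ := P.iterOne (n + 1) - P.iterOne n)
      (fun y _ hyx => (P.differentiableAt_iterOne _ (hmem y hyx)).sub
        (P.differentiableAt_iterOne _ fun h =>
          hmem y hyx (P.singularOrbit_mono (Nat.le_succ n) h)))
    rw [hsub, hd.deriv, iterSum_succ]
    have hsm := congrFun (P.isLinearMap_PF.map_smul (G * η ^ (n + 1))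
      (P.iterSum n + fun _ => 1)) x
    rw [Pi.smul_apply, smul_eq_mul] at hsm
    rw [← hsm]
    refine hdb.trans (P.PF_mono fun y hy hyx => ?_)
    have e1 := ih hy (hmem y hyx)
    have e2 := hB n y hy
    have hlam : 0 < P.lam := by linarith [P.lam_gt_one]
    have hη : 0 ≤ η := hθ.trans hθη
    have hS := P.iterSum_nonneg n y
    simp only [Pi.smul_apply, Pi.add_apply, Pi.sub_apply, smul_eq_mul]
    calc _ ≤ (G * η ^ n * P.iterSum n y) * η + A * (B * η ^ n) := by
          rw [div_eq_mul_inv]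
          gcongr
          exact e2.trans (by gcongr)
      _ = G * η ^ (n + 1) * P.iterSum n y + (A * B) * η ^ n := by ring
      _ ≤ G * η ^ (n + 1) * P.iterSum n y + (G * η) * η ^ n := by gcongr
      _ = _ := by ring

theorem bvOn_const (r : ℝ) : bvOn fun _ => r := by
  unfold bvOn BoundedVariationOn
  rw [eVariationOn.constant_on]
  · exact ENNReal.zero_ne_top
  · exact subsingleton_singleton.anti (by rintro _ ⟨_, _, rfl⟩; rfl)

/-- Under mixing, the invariant density is differentiable at any interior point that is not in
the orbits of `0`, `c`, `1` and is not approached exponentially fast by them. -/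
theorem exists_rate_differentiableAt {P : PEUM} {ρ : ℝ → ℝ} {θ : ℝ} (hmix : P.Mixing ρ θ) :
    ∃ β : ℝ, 0 < β ∧ β < 1 ∧ ∀ x ∈ Ioo (0:ℝ) 1,
      (∀ a ∈ ({0, P.c, 1} : Set ℝ), (∀ n, P.f^[n] a ≠ x) ∧
        ∀ᶠ n in atTop, β ^ n < |P.f^[n] a - x|) → DifferentiableAt ℝ ρ x := by
  obtain ⟨hθ0, hθ1, C, hC, hmix⟩ := hmix
  obtain ⟨A, hA0, hA⟩ := P.exists_abs_deriv_deriv_le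
  set M : ℝ := C * bvNorm fun _ => 1 with hM
  have happ : ∀ n, ∀ x ∈ Icc (0:ℝ) 1, |P.iterOne n x - ρ x| ≤ M * θ ^ n := by
    intro n x hx
    have h := hmix _ (bvOn_const 1) n x hx
    rw [show (∫ z in Icc (0:ℝ) 1, (1:ℝ)) = 1 by simp, one_mul] at h
    exact h.trans (le_of_eq (by rw [hM]; ring))
  have hM0 : 0 ≤ M := by
    have := (abs_nonneg _).trans (happ 0 0 (by simp))
    simpa using this
  have hB : ∀ n, ∀ x ∈ Icc (0:ℝ) 1, |P.iterOne (n + 1) x - P.iterOne n x| ≤ 2 * M * θ ^ n := by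
    intro n x hx
    have h1 := happ (n + 1) x hx
    have h2 := happ n x hx
    have h3 : M * θ ^ (n + 1) ≤ M * θ ^ n :=
      mul_le_mul_of_nonneg_left (pow_le_pow_of_le_one hθ0.le hθ1.le (Nat.le_succ n)) hM0
    rw [abs_le] at *
    constructor <;> linarith
  set K : ℝ := 1 + 2 * M with hKdef
  have hK : ∀ n, ∀ x ∈ Icc (0:ℝ) 1, P.iterOne n x ≤ K := by
    intro n x hx
    have h1 := (abs_le.1 (happ n x hx)).2
    have h2 := (abs_le.1 (happ 0 x hx)).1
    have h3 : M * θ ^ n ≤ M * 1 := mul_le_mul_of_nonneg_left (pow_le_one₀ hθ0.le hθ1.le) hM0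
    have h4 : P.iterOne 0 x = 1 := rfl
    rw [h4, pow_zero] at h2
    linarith
  have hlam := P.lam_gt_one
  set η : ℝ := max θ P.lam⁻¹ with hη
  have hη0 : 0 < η := hθ0.trans_le (le_max_left _ _)
  have hη1 : η < 1 := max_lt hθ1 (inv_lt_one_of_one_lt₀ hlam)
  have hK0 : 0 ≤ K := by positivity
  set G : ℝ := A * K + A * (2 * M) / η with hG
  have hG0 : 0 ≤ G := by positivity
  have hGK : A * K ≤ G := le_add_of_nonneg_right (by positivity)
  have hGB : A * (2 * M) ≤ G * η := by
    rw [hG, add_mul, div_mul_cancel₀ _ hη0.ne']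
    exact le_add_of_nonneg_left (by positivity)
  have hiterSum : ∀ n, ∀ x ∈ Icc (0:ℝ) 1, P.iterSum n x ≤ (n + 1) * K := by
    intro n x hx
    simp only [iterSum, Pi.add_apply, Finset.sum_apply]
    have h := Finset.sum_le_card_nsmul (Finset.range n) (fun i => P.iterOne (i + 1) x) K
      fun i _ => hK (i + 1) x hx
    rw [Finset.card_range, nsmul_eq_mul] at h
    linarith [hK n x hx]
  have hsum : Summable fun n : ℕ => G * η ^ n * ((n + 1) * K) := by
    have hn : ‖η‖ < 1 := by rwa [Real.norm_eq_abs, abs_of_pos hη0]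
    have h1 := summable_pow_mul_geometric_of_norm_lt_one 1 hn
    have h0 := summable_pow_mul_geometric_of_norm_lt_one 0 hn
    refine ((h1.add h0).mul_left (G * K)).congr fun n => ?_
    ring
  have hβ0 : (0:ℝ) < (θ + 1) / 2 := by linarith
  have hβ1 : (θ + 1) / 2 < 1 := by linarith
  refine ⟨(θ + 1) / 2, hβ0, hβ1, fun x hx hxorb => ?_⟩
  set β : ℝ := (θ + 1) / 2 with hβ
  have hpow : Tendsto (fun n : ℕ => β ^ n) atTop (𝓝 0) :=
    tendsto_pow_atTop_nhds_zero_of_lt_one hβ0.le hβ1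
  have hfar : ∀ a ∈ ({0, P.c, 1} : Set ℝ), ∀ᶠ n in atTop, ∀ k ≤ n,
      β ^ n < |P.f^[k] a - x| := by
    intro a ha
    obtain ⟨hne, hev⟩ := hxorb a ha
    obtain ⟨N, hN⟩ := eventually_atTop.1 hev
    have hfin : ∀ᶠ n in atTop, ∀ k ∈ Finset.range N, β ^ n < |P.f^[k] a - x| := by
      rw [Filter.eventually_all_finset]
      exact fun k _ => hpow.eventually (gt_mem_nhds (abs_pos.2 (sub_ne_zero.2 (hne k))))
    filter_upwards [hfin] with n hn k hkn
    rcases lt_or_ge k N with h | h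
    · exact hn k (Finset.mem_range.2 h)
    · exact (pow_le_pow_of_le_one hβ0.le hβ1.le hkn).trans_lt (hN k h)
  refine differentiableAt_of_approx_on_shrinking_balls (u := P.iterOne) hβ0 hβ1 hθ0.le
    (by linarith) hsum (K := M) ?_
  filter_upwards [hfar 0 (by simp), hfar P.c (by simp), hfar 1 (by simp),
    hpow.eventually (gt_mem_nhds hx.1), hpow.eventually (gt_mem_nhds (sub_pos.2 hx.2))]
    with n h0 hc h1 hl hr y hy
  rw [Metric.mem_closedBall, Real.dist_eq] at hy
  have hy' := abs_le.1 hy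
  have hy01 : y ∈ Icc (0:ℝ) 1 := ⟨by linarith, by linarith⟩
  have hyorb : y ∉ P.singularOrbit n := by
    rintro ⟨a, ha, k, hk, rfl⟩
    have : β ^ n < |P.f^[k + 1] a - x| := by
      rcases ha with rfl | rfl | rfl
      exacts [h0 _ hk, hc _ hk, h1 _ hk]
    exact absurd hy (not_le.2 this)
  have hd : ∀ k ≤ n, DifferentiableAt ℝ (P.iterOne k) y := fun k hk =>
    P.differentiableAt_iterOne k fun h => hyorb (P.singularOrbit_mono hk h)
  refine ⟨hd, fun k hk => ?_, happ n y hy01⟩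
  rw [← deriv_sub (hd (k + 1) hk) (hd k hk.le)]
  refine (P.abs_deriv_iterOne_succ_sub_le hA0 hA hB (by positivity) hθ0.le (le_max_left _ _)
    (le_max_right _ _) (hK 1) hGK hGB hG0 k hy01
    fun h => hyorb (P.singularOrbit_mono hk h)).trans ?_
  gcongr
  exact hiterSum k y hy01

end PEUM

/-- Theorem 2(A). For a mixing PEUM with `C²` branches, the set of points
of `[0,1]` where the invariant density `ρ` is not differentiable has Hausdorff dimension 0. -/
theorem nondifferentiability_set_dimH_zero (P : PEUM) (ρ : ℝ → ℝ) (θ : ℝ)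
    (hρ : P.IsInvariantDensity ρ) (hmix : P.Mixing ρ θ) :
    dimH {x ∈ Set.Icc (0:ℝ) 1 | ¬ DifferentiableAt ℝ ρ x} = 0 := by

  obtain ⟨β, hβ0, hβ1, hdiff⟩ := PEUM.exists_rate_differentiableAt hmix
  have hbad : ∀ a, dimH ({x | ∃ᶠ n in atTop, |P.f^[n] a - x| ≤ β ^ n} ∪
      range fun n => P.f^[n] a) = 0 := fun a => by
    rw [dimH_union, dimH_limsup_exponential_approach_eq_zero _ hβ0 hβ1,
      dimH_countable (countable_range _), max_self]
  have hsub : {x ∈ Set.Icc (0:ℝ) 1 | ¬ DifferentiableAt ℝ ρ x} ⊆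
      ⋃ a ∈ ({0, P.c, 1} : Set ℝ), ({x | ∃ᶠ n in atTop, |P.f^[n] a - x| ≤ β ^ n} ∪
        range fun n => P.f^[n] a) := by
    rintro x ⟨hx01, hx⟩
    by_contra hmem
    simp only [mem_iUnion, not_exists, mem_union, not_or, mem_ofPred_eq, mem_range] at hmem
    refine hx (hdiff x ⟨lt_of_le_of_ne hx01.1 ?_, lt_of_le_of_ne hx01.2 ?_⟩ fun a ha => ?_)
    · exact (hmem 0 (by simp)).2 0
    · exact fun h => (hmem 1 (by simp)).2 0 h.symm
    · refine ⟨(hmem a ha).2, ?_⟩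
      simpa only [not_frequently, not_le] using (hmem a ha).1
  refine le_antisymm ((dimH_mono hsub).trans ?_) bot_le
  rw [dimH_bUnion (by simp)]
  simp [hbad]
end

section
/- Let f be a mixing piecewise expanding unimodal map with C² branches. There exist constants M̄ > 0 and λ̄ > 1 such that for all positive integers k, i₁, …, i_k and positive integers m₁ > m₂ > … > m_k, and for all functions h₁, …, h_k of bounded variation on [0,1], one has ‖𝔇^{i₁,…,i_k}_{m₁,…,m_k}(h₁,…,h_k)‖_BV ≤ M̄ λ̄^{−i₁ m₁} λ̄^{−i₂ m₂} ⋯ λ̄^{−i_k m_k} ‖h₁‖_BV ‖h₂‖_BV ⋯ ‖h_k‖_BV, where ‖φ‖_BV = ‖φ‖_∞ + var(φ). -/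
open MeasureTheory Set Filter Topology Asymptotics
open scoped ENNReal NNReal

theorem eVariationOn_le_of_edist_le {f g h : ℝ → ℝ} {s : Set ℝ} {A B : ℝ≥0∞}
    (H : ∀ x ∈ s, ∀ y ∈ s, edist (h x) (h y) ≤ A * edist (f x) (f y) + B * edist (g x) (g y)) :
    eVariationOn h s ≤ A * eVariationOn f s + B * eVariationOn g s := by
  refine iSup_le fun ⟨n, u, hu, us⟩ => ?_
  calc ∑ i ∈ Finset.range n, edist (h (u (i + 1))) (h (u i))
      ≤ ∑ i ∈ Finset.range n, (A * edist (f (u (i + 1))) (f (u i)) +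
          B * edist (g (u (i + 1))) (g (u i))) :=
        Finset.sum_le_sum fun i _ => H _ (us _) _ (us _)
    _ = A * ∑ i ∈ Finset.range n, edist (f (u (i + 1))) (f (u i)) +
          B * ∑ i ∈ Finset.range n, edist (g (u (i + 1))) (g (u i)) := by
        rw [Finset.sum_add_distrib, Finset.mul_sum, Finset.mul_sum]
    _ ≤ _ := by
        gcongr
        · exact eVariationOn.sum_le hu us
        · exact eVariationOn.sum_le hu us

theorem eVariationOn_const (k : ℝ) (s : Set ℝ) : eVariationOn (fun _ => k) s = 0 :=
  eVariationOn.constant_on (by rintro _ ⟨_, _, rfl⟩ _ ⟨_, _, rfl⟩; rfl)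

theorem eVariationOn_mul_le {f g : ℝ → ℝ} {s : Set ℝ} {A B : ℝ≥0∞}
    (hf : ∀ x ∈ s, ‖f x‖ₑ ≤ A) (hg : ∀ x ∈ s, ‖g x‖ₑ ≤ B) :
    eVariationOn (fun x => f x * g x) s ≤ B * eVariationOn f s + A * eVariationOn g s := by
  refine eVariationOn_le_of_edist_le fun x hx y hy => ?_
  simp only [edist_eq_enorm_sub]
  calc ‖f x * g x - f y * g y‖ₑ = ‖(f x - f y) * g y + f x * (g x - g y)‖ₑ := by ring_nf
    _ ≤ ‖(f x - f y) * g y‖ₑ + ‖f x * (g x - g y)‖ₑ := enorm_add_le _ _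
    _ = ‖g y‖ₑ * ‖f x - f y‖ₑ + ‖f x‖ₑ * ‖g x - g y‖ₑ := by
        rw [enorm_mul, enorm_mul, mul_comm ‖f x - f y‖ₑ]
    _ ≤ _ := by
        gcongr
        · exact hg y hy
        · exact hf x hx

theorem eVariationOn_add_le (f g : ℝ → ℝ) (s : Set ℝ) :
    eVariationOn (fun x => f x + g x) s ≤ eVariationOn f s + eVariationOn g s := by
  have := eVariationOn_le_of_edist_le (f := f) (g := g) (h := fun x => f x + g x) (s := s)
    (A := 1) (B := 1) fun x _ y _ => by
      simpa using edist_add_add_le (f x) (g x) (f y) (g y)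
  simpa using this

theorem eVariationOn_abs_le (f : ℝ → ℝ) (s : Set ℝ) :
    eVariationOn (fun x => |f x|) s ≤ eVariationOn f s := by
  have := eVariationOn_le_of_edist_le (f := f) (g := f) (h := fun x => |f x|) (s := s)
    (A := 1) (B := 0) fun x _ y _ => by
      simp only [edist_eq_enorm_sub, one_mul, zero_mul, add_zero]
      rw [enorm_le_iff_norm_le]
      exact abs_abs_sub_abs_le _ _
  simpa using this

theorem eVariationOn_pow_le {f : ℝ → ℝ} {s : Set ℝ} {A : ℝ≥0∞}
    (hf : ∀ x ∈ s, ‖f x‖ₑ ≤ A) (m : ℕ) :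
    eVariationOn (fun x => f x ^ (m + 1)) s ≤ (m + 1) * A ^ m * eVariationOn f s := by
  induction m with
  | zero => simp
  | succ m ih =>
    have h1 := eVariationOn_mul_le (f := fun x => f x ^ (m + 1)) (g := f) (s := s)
      (A := A ^ (m + 1)) (B := A) (fun x hx => by
        rw [enorm_pow]; exact pow_le_pow_left' (hf x hx) _) hf
    calc eVariationOn (fun x => f x ^ (m + 1 + 1)) s
        ≤ A * eVariationOn (fun x => f x ^ (m + 1)) s + A ^ (m + 1) * eVariationOn f s := by
          simpa only [pow_succ] using h1
      _ ≤ A * ((m + 1) * A ^ m * eVariationOn f s) + A ^ (m + 1) * eVariationOn f s := by gcongr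
      _ = _ := by push_cast; ring

theorem eVariationOn_pow_mul_abs_le {f : ℝ → ℝ} {s : Set ℝ} {A : ℝ≥0∞}
    (hf : ∀ x ∈ s, ‖f x‖ₑ ≤ A) (m : ℕ) :
    eVariationOn (fun x => f x ^ m * |f x|) s ≤ (m + 1) * A ^ m * eVariationOn f s := by
  cases m with
  | zero => simpa using eVariationOn_abs_le f s
  | succ m =>
    calc eVariationOn (fun x => f x ^ (m + 1) * |f x|) s
        ≤ A * eVariationOn (fun x => f x ^ (m + 1)) s
            + A ^ (m + 1) * eVariationOn (fun x => |f x|) s := by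
          refine eVariationOn_mul_le (fun x hx => ?_) (fun x hx => ?_)
          · rw [enorm_pow]; exact pow_le_pow_left' (hf x hx) _
          · rw [← Real.norm_eq_abs, enorm_norm]; exact hf x hx
      _ ≤ A * ((m + 1) * A ^ m * eVariationOn f s) + A ^ (m + 1) * eVariationOn f s := by
          gcongr
          · exact eVariationOn_pow_le hf m
          · exact eVariationOn_abs_le f s
      _ = _ := by push_cast; ring

theorem eVariationOn_Icc_add_Icc (f : ℝ → ℝ) {a b c : ℝ} (hab : a ≤ b) (hbc : b ≤ c) :
    eVariationOn f (Icc a b) + eVariationOn f (Icc b c) = eVariationOn f (Icc a c) := by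
  simpa using eVariationOn.Icc_add_Icc f (s := univ) hab hbc (mem_univ b)

theorem eVariationOn_Icc_le_of_eqOn_Ioc {h : ℝ → ℝ} {a b k : ℝ} (hab : a ≤ b)
    (hk : ∀ x ∈ Ioc a b, h x = k) : eVariationOn h (Icc a b) ≤ edist (h a) k := by
  set g : ℝ → ℝ := fun x => if x ≤ a then 0 else 1 with hg
  have hmono : Monotone g := by
    intro x y hxy
    simp only [hg]
    split_ifs <;> first | (exfalso; linarith) | norm_num
  have hgv : eVariationOn g (Icc a b) ≤ 1 := by
    have := (hmono.monotoneOn (Icc a b)).eVariationOn_eq (left_mem_Icc.2 hab)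
      (right_mem_Icc.2 hab)
    rw [inter_self] at this
    refine this.le.trans ?_
    rw [← ENNReal.ofReal_one]
    apply ENNReal.ofReal_le_ofReal
    simp only [hg]
    split_ifs <;> norm_num
  have := eVariationOn_le_of_edist_le (f := g) (g := g) (h := h) (s := Icc a b)
    (A := edist (h a) k) (B := 0) fun x hx y hy => by
      rcases hx.1.eq_or_lt with rfl | hx' <;> rcases hy.1.eq_or_lt with rfl | hy'
      · simp
      · simp [hg, hk y ⟨hy', hy.2⟩, not_le.2 hy', edist_eq_enorm_sub]
      · simp [hg, hk x ⟨hx', hx.2⟩, not_le.2 hx', edist_eq_enorm_sub, enorm_sub_rev]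
      · simp [hk x ⟨hx', hx.2⟩, hk y ⟨hy', hy.2⟩]
  refine this.trans ?_
  calc _ ≤ edist (h a) k * 1 + 0 := by gcongr; simp
    _ = _ := by simp

theorem eVariationOn_Icc_le_of_eqOn_Ico {h : ℝ → ℝ} {a b k : ℝ} (hab : a ≤ b)
    (hk : ∀ x ∈ Ico a b, h x = k) : eVariationOn h (Icc a b) ≤ edist (h b) k := by
  have h1 := eVariationOn.comp_eq_of_antitoneOn h (t := Icc (-b) (-a)) (fun x => -x)
    (fun x _ y _ hxy => neg_le_neg hxy)
  have h2 : (fun x : ℝ => -x) '' Icc (-b) (-a) = Icc a b := by simp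
  rw [← h2, ← h1]
  have h3 := eVariationOn_Icc_le_of_eqOn_Ioc (h := h ∘ fun x => -x) (a := -b) (b := -a) (k := k)
    (neg_le_neg hab) (fun x hx => hk _ ⟨by linarith [hx.2], by linarith [hx.1]⟩)
  simpa using h3

theorem eVariationOn_Icc_le_of_eqOn_Ioo {h : ℝ → ℝ} {a b k : ℝ} (hab : a < b)
    (hk : ∀ x ∈ Ioo a b, h x = k) :
    eVariationOn h (Icc a b) ≤ edist (h a) k + edist (h b) k := by
  obtain ⟨c, hac, hcb⟩ := exists_between hab
  rw [← eVariationOn_Icc_add_Icc h hac.le hcb.le]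
  exact add_le_add
    (eVariationOn_Icc_le_of_eqOn_Ioc hac.le fun x hx => hk x ⟨hx.1, hx.2.trans_lt hcb⟩)
    (eVariationOn_Icc_le_of_eqOn_Ico hcb.le fun x hx => hk x ⟨hac.trans_le hx.1, hx.2⟩)

/-- Variation of a function transported by an injective continuous map of an interval and
extended by zero. -/
theorem eVariationOn_pushforward_le {f F G : ℝ → ℝ} {p q : ℝ} {B : ℝ≥0∞} (hpq : p ≤ q)
    (hf : ContinuousOn f (Icc p q)) (hinj : InjOn f (Icc p q))
    (hmaps : MapsTo f (Icc p q) (Icc 0 1)) (hFG : ∀ y ∈ Icc p q, F (f y) = G y)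
    (hF : ∀ x, x ∉ f '' Icc p q → F x = 0) (hB : ∀ y ∈ Icc p q, ‖G y‖ₑ ≤ B) :
    eVariationOn F (Icc 0 1) ≤ eVariationOn G (Icc p q) + 2 * B := by
  have hvar : eVariationOn F (f '' Icc p q) = eVariationOn G (Icc p q) := by
    have hc : eVariationOn (F ∘ f) (Icc p q) = eVariationOn G (Icc p q) :=
      eVariationOn.congr hFG
    rcases hf.strictMonoOn_of_injOn_Icc' hpq hinj with h | h
    · rw [← hc, eVariationOn.comp_eq_of_monotoneOn F f h.monotoneOn]
    · rw [← hc, eVariationOn.comp_eq_of_antitoneOn F f h.antitoneOn]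
  obtain ⟨a, b, himg⟩ : ∃ a b, f '' Icc p q = Icc a b := ⟨_, _, hf.image_Icc hpq⟩
  have hne : (Icc a b).Nonempty := himg ▸ (nonempty_Icc.2 hpq).image f
  have hab : a ≤ b := nonempty_Icc.1 hne
  have hsub : Icc a b ⊆ Icc 0 1 := himg ▸ hmaps.image_subset
  have ha := hsub (left_mem_Icc.2 hab)
  have hb := hsub (right_mem_Icc.2 hab)
  have hFB : ∀ x ∈ Icc a b, edist (F x) 0 ≤ B := by
    intro x hx
    rw [← himg] at hx
    obtain ⟨y, hy, rfl⟩ := hx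
    rw [hFG y hy, edist_zero_right]
    exact hB y hy
  rw [himg] at hvar hF
  rw [← eVariationOn_Icc_add_Icc F ha.1 ha.2, ← eVariationOn_Icc_add_Icc F hab hb.2, hvar]
  have h1 := eVariationOn_Icc_le_of_eqOn_Ico (h := F) (k := 0) ha.1
    fun x hx => hF x fun h => absurd h.1 (not_le.2 hx.2)
  have h2 := eVariationOn_Icc_le_of_eqOn_Ioc (h := F) (k := 0) hb.2
    fun x hx => hF x fun h => absurd h.2 (not_le.2 hx.1)
  calc _ ≤ B + (eVariationOn G (Icc p q) + B) := by
        gcongr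
        · exact h1.trans (hFB a (left_mem_Icc.2 hab))
        · exact h2.trans (hFB b (right_mem_Icc.2 hab))
    _ = _ := by ring

theorem eVariationOn_mul_weight_le {φ u e : ℝ → ℝ} {p q : ℝ} (hpq : p < q) {L S : ℝ≥0∞}
    (hφ : ∀ y ∈ Icc p q, ‖φ y‖ₑ ≤ S) (hu : ∀ y ∈ Icc p q, ‖u y‖ₑ ≤ L)
    (he : ∀ y, ‖e y‖ₑ ≤ 1) (he' : ∀ y, edist (e y) 1 ≤ 1) (he1 : ∀ y ∈ Ioo p q, e y = 1) (m : ℕ) :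
    eVariationOn (fun y => φ y * (u y ^ m * |u y| * e y)) (Icc p q) ≤
      L ^ (m + 1) * eVariationOn φ (Icc p q) +
        S * ((m + 1) * L ^ m * eVariationOn u (Icc p q) + 2 * L ^ (m + 1)) := by
  have hw : ∀ y ∈ Icc p q, ‖u y ^ m * |u y|‖ₑ ≤ L ^ (m + 1) := by
    intro y hy
    rw [enorm_mul, enorm_pow, ← Real.norm_eq_abs, enorm_norm, ← pow_succ]
    exact pow_le_pow_left' (hu y hy) _
  have hwe : ∀ y ∈ Icc p q, ‖u y ^ m * |u y| * e y‖ₑ ≤ L ^ (m + 1) := by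
    intro y hy
    rw [enorm_mul]
    exact (mul_le_mul' (hw y hy) (he y)).trans (mul_one _).le
  have hev : eVariationOn e (Icc p q) ≤ 2 :=
    (eVariationOn_Icc_le_of_eqOn_Ioo hpq he1).trans
      ((add_le_add (he' p) (he' q)).trans one_add_one_eq_two.le)
  refine (eVariationOn_mul_le hφ hwe).trans ?_
  gcongr
  refine (eVariationOn_mul_le hw fun y _ => he y).trans ?_
  rw [one_mul]
  refine add_le_add (eVariationOn_pow_mul_abs_le hu m) ?_
  rw [mul_comm 2]
  gcongr

theorem deriv_eq_zero_or_eq_of_eqOn_Icc {f g : ℝ → ℝ} {p q y : ℝ} (hpq : p < q)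
    (hfg : EqOn f g (Icc p q)) (hy : y ∈ Icc p q) (hg : DifferentiableAt ℝ g y) :
    deriv f y = 0 ∨ deriv f y = deriv g y := by
  by_cases hf : DifferentiableAt ℝ f y
  · right
    have hu := uniqueDiffOn_Icc hpq y hy
    rw [← hf.derivWithin hu, ← hg.derivWithin hu]
    exact derivWithin_congr hfg (hfg hy)
  · exact Or.inl (deriv_zero_of_not_differentiableAt hf)

theorem deriv_eq_of_eqOn_Icc {f g : ℝ → ℝ} {p q y : ℝ}
    (hfg : EqOn f g (Icc p q)) (hy : y ∈ Ioo p q) : deriv f y = deriv g y :=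
  Filter.EventuallyEq.deriv_eq (hfg.eventuallyEq_of_mem (Icc_mem_nhds hy.1 hy.2))

theorem injOn_Icc_of_deriv_ne_zero {g : ℝ → ℝ} {p q : ℝ}
    (hg : ∀ x ∈ Icc p q, deriv g x ≠ 0) : InjOn g (Icc p q) := by
  have key : ∀ x ∈ Icc p q, ∀ y ∈ Icc p q, x < y → g x ≠ g y := by
    intro x hx y hy hxy h
    have hsub : Icc x y ⊆ Icc p q := Icc_subset_Icc hx.1 hy.2
    obtain ⟨z, hz, hz0⟩ := exists_deriv_eq_zero hxy (fun z hz =>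
      (differentiableAt_of_deriv_ne_zero (hg z (hsub hz))).continuousAt.continuousWithinAt) h
    exact hg z (hsub (Ioo_subset_Icc_self hz)) hz0
  intro x hx y hy h
  rcases lt_trichotomy x y with hlt | rfl | hlt
  · exact absurd h (key x hx y hy hlt)
  · rfl
  · exact absurd h.symm (key y hy x hx hlt)

theorem eVariationOn_inv_deriv_ne_top {g : ℝ → ℝ} {p q lam : ℝ} (hpq : p < q)
    (hg : ContDiffOn ℝ 2 g (Icc p q)) (hlam : 0 < lam)
    (hexp : ∀ x ∈ Icc p q, lam ≤ |deriv g x|) :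
    eVariationOn (fun x => (deriv g x)⁻¹) (Icc p q) ≠ ⊤ := by
  have hu := uniqueDiffOn_Icc hpq
  have hne : ∀ x ∈ Icc p q, deriv g x ≠ 0 := fun x hx =>
    abs_pos.1 (hlam.trans_le (hexp x hx))
  have h1 : ContDiffOn ℝ 1 (derivWithin g (Icc p q)) (Icc p q) :=
    hg.derivWithin hu (by norm_num)
  have h2 : ContDiffOn ℝ 1 (fun x => (deriv g x)⁻¹) (Icc p q) :=
    (h1.congr fun x hx =>
      ((differentiableAt_of_deriv_ne_zero (hne x hx)).derivWithin (hu x hx)).symm).inv hne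
  obtain ⟨K, hK⟩ := h2.exists_lipschitzOnWith one_ne_zero (convex_Icc p q) isCompact_Icc
  have := hK.locallyBoundedVariationOn p q (left_mem_Icc.2 hpq.le) (right_mem_Icc.2 hpq.le)
  rwa [inter_self] at this

namespace PEUM

variable (P : PEUM)

theorem eqOn_left : EqOn P.f P.f₁ (Icc 0 P.c) := fun x hx =>
  P.eq₁ x ⟨hx.1, hx.2.trans P.c_mem.2.le⟩ hx.2

theorem eqOn_right : EqOn P.f P.f₂ (Icc P.c 1) := fun x hx =>
  P.eq₂ x ⟨P.c_mem.1.le.trans hx.1, hx.2⟩ hx.1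

theorem le_abs_deriv_left {x : ℝ} (hx : x ∈ Icc 0 P.c) : P.lam ≤ |deriv P.f₁ x| :=
  P.expand₁ x ⟨hx.1, by linarith [hx.2, P.eps_pos]⟩

theorem le_abs_deriv_right {x : ℝ} (hx : x ∈ Icc P.c 1) : P.lam ≤ |deriv P.f₂ x| :=
  P.expand₂ x ⟨by linarith [hx.1, P.eps_pos], hx.2⟩

theorem lam_pos : 0 < P.lam := one_pos.trans P.lam_gt_one

theorem deriv_left_ne_zero {x : ℝ} (hx : x ∈ Icc 0 P.c) : deriv P.f₁ x ≠ 0 :=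
  abs_pos.1 (P.lam_pos.trans_le (P.le_abs_deriv_left hx))

theorem deriv_right_ne_zero {x : ℝ} (hx : x ∈ Icc P.c 1) : deriv P.f₂ x ≠ 0 :=
  abs_pos.1 (P.lam_pos.trans_le (P.le_abs_deriv_right hx))

theorem deriv_left {x : ℝ} (hx : x ∈ Icc 0 P.c) :
    deriv P.f x = 0 ∨ deriv P.f x = deriv P.f₁ x :=
  deriv_eq_zero_or_eq_of_eqOn_Icc P.c_mem.1 P.eqOn_left hx
    (differentiableAt_of_deriv_ne_zero (P.deriv_left_ne_zero hx))

theorem deriv_right {x : ℝ} (hx : x ∈ Icc P.c 1) :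
    deriv P.f x = 0 ∨ deriv P.f x = deriv P.f₂ x :=
  deriv_eq_zero_or_eq_of_eqOn_Icc P.c_mem.2 P.eqOn_right hx
    (differentiableAt_of_deriv_ne_zero (P.deriv_right_ne_zero hx))

/-- At the endpoints and at the critical point `deriv P.f` may take the default value `0`. -/
theorem deriv_eq_zero_or_lam_le {x : ℝ} (hx : x ∈ Icc (0 : ℝ) 1) :
    deriv P.f x = 0 ∨ P.lam ≤ |deriv P.f x| := by
  rcases le_total x P.c with h | h
  · rcases P.deriv_left ⟨hx.1, h⟩ with h0 | h0
    · exact Or.inl h0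
    · exact Or.inr (h0 ▸ P.le_abs_deriv_left ⟨hx.1, h⟩)
  · rcases P.deriv_right ⟨h, hx.2⟩ with h0 | h0
    · exact Or.inl h0
    · exact Or.inr (h0 ▸ P.le_abs_deriv_right ⟨h, hx.2⟩)

instance finite_preimage (x : ℝ) : Finite {y : ℝ // y ∈ Icc (0 : ℝ) 1 ∧ P.f y = x} := by
  refine Set.Finite.to_subtype (s := {y : ℝ | y ∈ Icc (0 : ℝ) 1 ∧ P.f y = x}) ?_
  have h1 : ({y : ℝ | y ∈ Icc 0 P.c ∧ P.f y = x}).Subsingleton :=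
    fun y hy z hz => P.injOn_left hy.1 hz.1 (hy.2.trans hz.2.symm)
  have h2 : ({y : ℝ | y ∈ Icc P.c 1 ∧ P.f y = x}).Subsingleton :=
    fun y hy z hz => P.injOn_right hy.1 hz.1 (hy.2.trans hz.2.symm)
  refine (h1.finite.union h2.finite).subset fun y hy => ?_
  rcases le_total y P.c with h | h
  · exact Or.inl ⟨⟨hy.1.1, h⟩, hy.2⟩
  · exact Or.inr ⟨⟨h, hy.1.2⟩, hy.2⟩

/-- Variation of the sum over preimages of a function supported on one branch. -/
theorem eVariationOn_tsum_preimage_le {G : ℝ → ℝ} {p q : ℝ} {B : ℝ≥0∞} (hpq : p ≤ q)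
    (hsub : Icc p q ⊆ Icc 0 1) (hf : ContinuousOn P.f (Icc p q)) (hinj : InjOn P.f (Icc p q))
    (hG : ∀ y ∈ Icc (0 : ℝ) 1, y ∉ Icc p q → G y = 0) (hB : ∀ y ∈ Icc p q, ‖G y‖ₑ ≤ B) :
    eVariationOn (fun x => ∑' y : {y : ℝ // y ∈ Icc (0 : ℝ) 1 ∧ P.f y = x}, G y.1) (Icc 0 1) ≤
      eVariationOn G (Icc p q) + 2 * B := by
  refine eVariationOn_pushforward_le hpq hf hinj (fun y hy => P.mapsTo (hsub hy)) ?_ ?_ hB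
  · intro y hy
    refine tsum_eq_single (⟨y, hsub hy, rfl⟩ : {z : ℝ // z ∈ Icc (0 : ℝ) 1 ∧ P.f z = P.f y}) ?_
    rintro ⟨z, hz, hzy⟩ hne
    refine hG z hz fun hz' => hne ?_
    exact Subtype.ext (hinj hz' hy hzy)
  · intro x hx
    convert tsum_zero with y
    exact hG y.1 y.2.1 fun hy => hx ⟨y.1, hy, y.2.2⟩

theorem enorm_inv_le {L : ℝ≥0∞} (hL : L = ENNReal.ofReal P.lam⁻¹) {d : ℝ} (hd : P.lam ≤ |d|) :
    ‖d⁻¹‖ₑ ≤ L := by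
  rw [hL, ← ofReal_norm, norm_inv, Real.norm_eq_abs]
  exact ENNReal.ofReal_le_ofReal (inv_anti₀ P.lam_pos hd)

/-- Total variation of the inverse derivatives of both branches. -/
noncomputable def distortion : ℝ≥0∞ :=
  eVariationOn (fun x => (deriv P.f₁ x)⁻¹) (Icc 0 P.c) +
    eVariationOn (fun x => (deriv P.f₂ x)⁻¹) (Icc P.c 1)

theorem distortion_ne_top : P.distortion ≠ ⊤ :=
  ENNReal.add_ne_top.2
    ⟨eVariationOn_inv_deriv_ne_top P.c_mem.1
      (P.smooth₁.mono (Icc_subset_Icc le_rfl (by linarith [P.eps_pos]))) P.lam_pos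
      fun _ => P.le_abs_deriv_left,
    eVariationOn_inv_deriv_ne_top P.c_mem.2
      (P.smooth₂.mono (Icc_subset_Icc (by linarith [P.eps_pos]) le_rfl)) P.lam_pos
      fun _ => P.le_abs_deriv_right⟩

/-- Lasota–Yorke inequality for one branch: `e` is a cutoff that may vanish only at endpoints. -/
theorem eVariationOn_branch_le {φ G u e : ℝ → ℝ} {p q : ℝ} {L S : ℝ≥0∞} (hpq : p < q)
    (hsub : Icc p q ⊆ Icc 0 1) (hf : ContinuousOn P.f (Icc p q)) (hinj : InjOn P.f (Icc p q))
    (hφ : ∀ y ∈ Icc (0 : ℝ) 1, ‖φ y‖ₑ ≤ S) (hu : ∀ y ∈ Icc p q, ‖u y‖ₑ ≤ L)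
    (he : ∀ y, e y = 0 ∨ e y = 1) (he1 : ∀ y ∈ Ioo p q, e y = 1) (m : ℕ)
    (hG : ∀ y ∈ Icc (0 : ℝ) 1, y ∉ Icc p q → G y = 0)
    (hGe : ∀ y ∈ Icc p q, G y = φ y * (u y ^ m * |u y| * e y)) :
    eVariationOn (fun x => ∑' y : {y : ℝ // y ∈ Icc (0 : ℝ) 1 ∧ P.f y = x}, G y.1) (Icc 0 1) ≤
      L ^ (m + 1) * eVariationOn φ (Icc p q) +
        S * ((m + 1) * L ^ m * eVariationOn u (Icc p q) + 4 * L ^ (m + 1)) := by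
  have he' : ∀ y, ‖e y‖ₑ ≤ 1 := fun y => by rcases he y with h | h <;> simp [h]
  have he'' : ∀ y, edist (e y) 1 ≤ 1 := fun y => by
    rcases he y with h | h <;> simp [h, edist_eq_enorm_sub]
  have hGB : ∀ y ∈ Icc p q, ‖G y‖ₑ ≤ S * L ^ (m + 1) := by
    intro y hy
    rw [hGe y hy, enorm_mul, enorm_mul, enorm_mul, enorm_pow, ← Real.norm_eq_abs, enorm_norm,
      ← pow_succ]
    calc _ ≤ S * (L ^ (m + 1) * 1) := by
          gcongr
          · exact hφ y (hsub hy)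
          · exact hu y hy
          · exact he' y
      _ = _ := by rw [mul_one]
  refine (P.eVariationOn_tsum_preimage_le hpq.le hsub hf hinj hG hGB).trans ?_
  rw [eVariationOn.congr (show EqOn G (fun y => φ y * (u y ^ m * |u y| * e y)) (Icc p q) from hGe)]
  calc _ ≤ _ := add_le_add_left (eVariationOn_mul_weight_le hpq (fun y hy => hφ y (hsub hy)) hu
          he' he'' he1 m) _
    _ = _ := by ring

/-- Lasota–Yorke inequality for the weighted transfer operators. -/
theorem eVariationOn_transfer_le {φ : ℝ → ℝ} {L S : ℝ≥0∞} (hL : L = ENNReal.ofReal P.lam⁻¹)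
    (hφ : ∀ y ∈ Icc (0 : ℝ) 1, ‖φ y‖ₑ ≤ S) (m : ℕ) :
    eVariationOn (P.transfer m φ) (Icc 0 1) ≤
      L ^ (m + 1) * eVariationOn φ (Icc 0 1) +
        (m + 1) * (P.distortion + 8) * L ^ m * S := by
  set t : ℝ → ℝ := fun y => φ y / (deriv P.f y ^ m * |deriv P.f y|) with ht
  have ht0 : ∀ y, deriv P.f y = 0 → t y = 0 := fun y hy => by simp [ht, hy]
  have ht1 : ∀ y d, deriv P.f y = d → t y = φ y * (d⁻¹ ^ m * |d⁻¹| * 1) := fun y d hy => by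
    simp only [ht, hy, div_eq_mul_inv, mul_inv, inv_pow, abs_inv, mul_one]
  set G₁ : ℝ → ℝ := fun y => if y ≤ P.c then t y else 0 with hG₁
  set G₂ : ℝ → ℝ := fun y => if y ≤ P.c then 0 else t y with hG₂
  have hsplit : P.transfer m φ = fun x =>
      (∑' y : {y : ℝ // y ∈ Icc (0 : ℝ) 1 ∧ P.f y = x}, G₁ y.1) +
        ∑' y : {y : ℝ // y ∈ Icc (0 : ℝ) 1 ∧ P.f y = x}, G₂ y.1 := by
    funext x
    rw [← (Summable.of_finite).tsum_add (Summable.of_finite)]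
    refine tsum_congr fun y => ?_
    simp only [hG₁, hG₂, ht]
    split_ifs <;> simp
  have h1 := P.eVariationOn_branch_le (φ := φ) (G := G₁) (u := fun y => (deriv P.f₁ y)⁻¹)
    (e := fun y => if deriv P.f y = 0 then 0 else 1) (L := L) (S := S) P.c_mem.1
    (Icc_subset_Icc le_rfl P.c_mem.2.le) P.continuousOn_left P.injOn_left hφ
    (fun y hy => P.enorm_inv_le hL (P.le_abs_deriv_left hy))
    (fun y => by split_ifs <;> simp)
    (fun y hy => by
      rw [deriv_eq_of_eqOn_Icc P.eqOn_left hy,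
        if_neg (P.deriv_left_ne_zero (Ioo_subset_Icc_self hy))]) m
    (fun y hy hy' => if_neg fun h => hy' ⟨hy.1, h⟩)
    (fun y hy => by
      simp only [hG₁, if_pos hy.2]
      rcases P.deriv_left hy with h | h
      · simp [ht0 y h, h]
      · rw [if_neg (h ▸ P.deriv_left_ne_zero hy), ht1 y _ h])
  have h2 := P.eVariationOn_branch_le (φ := φ) (G := G₂) (u := fun y => (deriv P.f₂ y)⁻¹)
    (e := fun y => if y ≤ P.c ∨ deriv P.f y = 0 then 0 else 1) (L := L) (S := S) P.c_mem.2
    (Icc_subset_Icc P.c_mem.1.le le_rfl) P.continuousOn_right P.injOn_right hφ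
    (fun y hy => P.enorm_inv_le hL (P.le_abs_deriv_right hy))
    (fun y => by split_ifs <;> simp)
    (fun y hy => by
      rw [deriv_eq_of_eqOn_Icc P.eqOn_right hy,
        if_neg (not_or.2 ⟨not_le.2 hy.1, P.deriv_right_ne_zero (Ioo_subset_Icc_self hy)⟩)]) m
    (fun y hy hy' => if_pos (not_lt.1 fun h => hy' ⟨h.le, hy.2⟩))
    (fun y hy => by
      simp only [hG₂]
      by_cases hyc : y ≤ P.c
      · simp [hyc]
      rw [if_neg hyc]
      rcases P.deriv_right hy with h | h
      · simp [ht0 y h, h]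
      · rw [if_neg (not_or.2 ⟨hyc, h ▸ P.deriv_right_ne_zero hy⟩), ht1 y _ h])
  have hL1 : L ≤ 1 := by
    rw [hL, ← ENNReal.ofReal_one]
    exact ENNReal.ofReal_le_ofReal (inv_le_one_of_one_le₀ P.lam_gt_one.le)
  rw [hsplit]
  refine (eVariationOn_add_le _ _ _).trans ((add_le_add h1 h2).trans ?_)
  rw [← eVariationOn_Icc_add_Icc φ P.c_mem.1.le P.c_mem.2.le, distortion]
  set U₁ := eVariationOn (fun x => (deriv P.f₁ x)⁻¹) (Icc 0 P.c)
  set U₂ := eVariationOn (fun x => (deriv P.f₂ x)⁻¹) (Icc P.c 1)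
  set V₁ := eVariationOn φ (Icc 0 P.c)
  set V₂ := eVariationOn φ (Icc P.c 1)
  have hLm : L ^ (m + 1) ≤ (m + 1) * L ^ m := by
    rw [pow_succ, mul_comm]
    gcongr
    exact hL1.trans (by simp)
  calc _ = L ^ (m + 1) * (V₁ + V₂) +
        S * ((m + 1) * L ^ m * (U₁ + U₂) + 8 * L ^ (m + 1)) := by ring
    _ ≤ L ^ (m + 1) * (V₁ + V₂) +
        S * ((m + 1) * L ^ m * (U₁ + U₂) + 8 * ((m + 1) * L ^ m)) := by gcongr
    _ = _ := by ring

theorem abs_transfer_le {φ Φ : ℝ → ℝ} (h : ∀ y ∈ Icc (0 : ℝ) 1, |φ y| ≤ Φ y) (m : ℕ) (x : ℝ) :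
    |P.transfer m φ x| ≤ P.lam⁻¹ ^ m * P.PF Φ x := by
  have := Fintype.ofFinite {y : ℝ // y ∈ Icc (0 : ℝ) 1 ∧ P.f y = x}
  simp only [PF, transfer, tsum_fintype, Finset.mul_sum]
  refine (Finset.abs_sum_le_sum_abs _ _).trans (Finset.sum_le_sum fun y _ => ?_)
  rw [abs_div, abs_mul, abs_pow, abs_abs, pow_zero, one_mul]
  rcases P.deriv_eq_zero_or_lam_le y.2.1 with h0 | h0
  · simp [h0]
  · have hd : 0 < |deriv P.f y| := P.lam_pos.trans_le h0
    calc |φ y| / (|deriv P.f y| ^ m * |deriv P.f y|)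
        = |deriv P.f y|⁻¹ ^ m * (|φ y| / |deriv P.f y|) := by rw [inv_pow]; field_simp
      _ ≤ P.lam⁻¹ ^ m * (Φ y / |deriv P.f y|) := by
        have := P.lam_pos
        gcongr
        exact h y y.2.1

theorem PF_const_mul (a : ℝ) (φ : ℝ → ℝ) : P.PF (fun y => a * φ y) = fun x => a * P.PF φ x := by
  funext x
  simp only [PF, transfer, mul_div_assoc, tsum_mul_left]

theorem abs_iterate_transfer_le {φ : ℝ → ℝ} {S : ℝ} (h : ∀ y ∈ Icc (0 : ℝ) 1, |φ y| ≤ S)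
    (m i : ℕ) : ∀ x ∈ Icc (0 : ℝ) 1,
      |(P.transfer m)^[i] φ x| ≤ P.lam⁻¹ ^ (m * i) * S * P.PF^[i] (fun _ => 1) x := by
  induction i with
  | zero => simpa using h
  | succ i ih =>
    intro x _
    rw [Function.iterate_succ_apply', Function.iterate_succ_apply']
    refine (P.abs_transfer_le ih m x).trans (le_of_eq ?_)
    rw [P.PF_const_mul]
    ring

theorem Mixing.exists_PF_iterate_one_le {P : PEUM} {ρ : ℝ → ℝ} {θ : ℝ} (hρ : P.IsInvariantDensity ρ)
    (hmix : P.Mixing ρ θ) :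
    ∃ D : ℝ, 0 ≤ D ∧ ∀ i, ∀ x ∈ Icc (0 : ℝ) 1, P.PF^[i] (fun _ => 1) x ≤ D := by
  obtain ⟨h0, h1, C, hC, H⟩ := hmix
  have hb : bvOn fun _ => (1 : ℝ) := by
    simp [bvOn, BoundedVariationOn, eVariationOn_const]
  have hN : 0 ≤ bvNorm fun _ => (1 : ℝ) :=
    add_nonneg (Real.iSup_nonneg fun _ => abs_nonneg _) ENNReal.toReal_nonneg
  set N := bvNorm fun _ => (1 : ℝ)
  set I := ∫ _ in Icc (0 : ℝ) 1, (1 : ℝ)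
  set R := |ρ 0| + var01 ρ
  have hR : ∀ x ∈ Icc (0 : ℝ) 1, |ρ x| ≤ R := by
    intro x hx
    have h := hρ.1.dist_le hx (left_mem_Icc.2 zero_le_one)
    rw [Real.dist_eq] at h
    have := abs_sub_abs_le_abs_sub (ρ x) (ρ 0)
    simp only [R, var01]
    linarith
  refine ⟨C * N + |I| * R, ?_, fun i x hx => ?_⟩
  · have : 0 ≤ R := (abs_nonneg _).trans (hR 0 (left_mem_Icc.2 zero_le_one))
    positivity
  · have h := (le_abs_self _).trans (H _ hb i x hx)
    have h2 : C * θ ^ i * N ≤ C * N := by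
      have : θ ^ i ≤ 1 := pow_le_one₀ h0.le h1.le
      have : C * θ ^ i ≤ C * 1 := by gcongr
      nlinarith
    have h3 : I * ρ x ≤ |I| * R := by
      calc I * ρ x ≤ |I * ρ x| := le_abs_self _
        _ = |I| * |ρ x| := abs_mul _ _
        _ ≤ _ := by gcongr; exact hR x hx
    linarith

end PEUM

theorem enorm_le_iSup_Icc (φ : ℝ → ℝ) {x : ℝ} (hx : x ∈ Icc (0 : ℝ) 1) :
    ‖φ x‖ₑ ≤ ⨆ x : Icc (0 : ℝ) 1, (‖φ (x : ℝ)‖₊ : ℝ≥0∞) :=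
  le_iSup (fun x : Icc (0 : ℝ) 1 => (‖φ (x : ℝ)‖₊ : ℝ≥0∞)) ⟨x, hx⟩

theorem eBVnorm_mul_le (f g : ℝ → ℝ) :
    eBVnorm (fun x => f x * g x) ≤ eBVnorm f * eBVnorm g := by
  have hv := eVariationOn_mul_le (f := f) (g := g) (s := Icc 0 1)
    (fun x hx => enorm_le_iSup_Icc f hx) (fun x hx => enorm_le_iSup_Icc g hx)
  simp only [eBVnorm]
  set A := ⨆ x : Icc (0 : ℝ) 1, (‖f (x : ℝ)‖₊ : ℝ≥0∞)
  set B := ⨆ x : Icc (0 : ℝ) 1, (‖g (x : ℝ)‖₊ : ℝ≥0∞)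
  set V := eVariationOn f (Icc 0 1)
  set W := eVariationOn g (Icc 0 1)
  have hs : (⨆ x : Icc (0 : ℝ) 1, (‖f x * g x‖₊ : ℝ≥0∞)) ≤ A * B := by
    refine iSup_le fun x => ?_
    rw [nnnorm_mul, ENNReal.coe_mul]
    exact mul_le_mul' (enorm_le_iSup_Icc f x.2) (enorm_le_iSup_Icc g x.2)
  calc _ ≤ A * B + (B * V + A * W) := add_le_add hs hv
    _ ≤ A * B + (B * V + A * W) + V * W := le_self_add
    _ = _ := by ring

theorem eBVnorm_one : eBVnorm (fun _ => 1) = 1 := by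
  have : Nonempty (Icc (0 : ℝ) 1) := ⟨0, left_mem_Icc.2 zero_le_one⟩
  simp [eBVnorm, eVariationOn_const]

/-- Uniform exponential decay of the weighted transfer operators on `BV`. -/
theorem PEUM.Mixing.exists_eBVnorm_iterate_transfer_le {P : PEUM} {ρ : ℝ → ℝ} {θ : ℝ}
    (hρ : P.IsInvariantDensity ρ) (hmix : P.Mixing ρ θ) :
    ∃ A : ℝ, 0 ≤ A ∧ ∀ (m i : ℕ) (φ : ℝ → ℝ), eBVnorm ((P.transfer m)^[i] φ) ≤
      ENNReal.ofReal A * (m + 1) * ENNReal.ofReal P.lam⁻¹ ^ (m * i) * eBVnorm φ := by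
  obtain ⟨D, hD0, hD⟩ := hmix.exists_PF_iterate_one_le hρ
  set L := ENNReal.ofReal P.lam⁻¹ with hL
  set K := P.distortion + 8
  have hK : K ≠ ⊤ := ENNReal.add_ne_top.2 ⟨P.distortion_ne_top, by simp⟩
  set R := ENNReal.ofReal (1 - P.lam⁻¹)⁻¹ with hRdef
  have hlam1 : P.lam⁻¹ < 1 := inv_lt_one_of_one_lt₀ P.lam_gt_one
  have hlam0 : 0 < P.lam⁻¹ := inv_pos.2 P.lam_pos
  have hR : L * R + 1 = R := by
    have h : 0 < 1 - P.lam⁻¹ := sub_pos.2 hlam1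
    rw [hL, hRdef, ← ENNReal.ofReal_mul hlam0.le, ← ENNReal.ofReal_one,
      ← ENNReal.ofReal_add (by positivity) zero_le_one]
    congr 1
    have key : ∀ x : ℝ, 0 < 1 - x → x * (1 - x)⁻¹ + 1 = (1 - x)⁻¹ := fun x hx => by
      field_simp
      ring
    exact key _ h
  set E := ENNReal.ofReal D
  set A := E + 1 + K * E * R
  have hA : A ≠ ⊤ := by finiteness
  refine ⟨A.toReal, ENNReal.toReal_nonneg, fun m i φ => ?_⟩
  rw [ENNReal.ofReal_toReal hA]
  rcases eq_or_ne (eBVnorm φ) ⊤ with htop | hfin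
  · rw [htop, ENNReal.mul_top]
    · exact le_top
    · refine mul_ne_zero (mul_ne_zero ?_ (by simp)) (pow_ne_zero _ ?_)
      · exact ((zero_lt_one.trans_le (le_add_self.trans le_self_add)).ne' : E + 1 + K * E * R ≠ 0)
      · exact (ENNReal.ofReal_pos.2 hlam0).ne'
  simp only [eBVnorm] at hfin ⊢
  set S := ⨆ x : Icc (0 : ℝ) 1, (‖φ (x : ℝ)‖₊ : ℝ≥0∞)
  set V := eVariationOn φ (Icc 0 1)
  have hStop : S ≠ ⊤ := (ENNReal.add_ne_top.1 hfin).1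
  have hSφ : ∀ y ∈ Icc (0 : ℝ) 1, |φ y| ≤ S.toReal := by
    intro y hy
    have := ENNReal.toReal_mono hStop (enorm_le_iSup_Icc φ hy)
    simpa using this
  have hsup : ∀ i, ∀ x ∈ Icc (0 : ℝ) 1, ‖(P.transfer m)^[i] φ x‖ₑ ≤ L ^ (m * i) * S * E := by
    intro i x hx
    have h := (P.abs_iterate_transfer_le hSφ m i x hx).trans
      (mul_le_mul_of_nonneg_left (hD i x hx) (by positivity))
    rw [← ofReal_norm, Real.norm_eq_abs]
    refine (ENNReal.ofReal_le_ofReal h).trans (le_of_eq ?_)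
    rw [ENNReal.ofReal_mul (by positivity), ENNReal.ofReal_mul (by positivity),
      ENNReal.ofReal_toReal hStop, ENNReal.ofReal_pow hlam0.le]
  have hvar : ∀ i, eVariationOn ((P.transfer m)^[i] φ) (Icc 0 1) ≤
      L ^ (m * i) * (L ^ i * V + (m + 1) * K * E * R * S) := by
    intro i
    induction i with
    | zero => simp [V]
    | succ i ih =>
      rw [Function.iterate_succ_apply']
      refine (P.eVariationOn_transfer_le hL (hsup i) m).trans ?_
      calc _ ≤ L ^ (m + 1) * (L ^ (m * i) * (L ^ i * V + (m + 1) * K * E * R * S)) +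
            (m + 1) * K * L ^ m * (L ^ (m * i) * S * E) := by gcongr
        _ = L ^ (m * (i + 1)) *
              (L ^ (i + 1) * V + (m + 1) * K * E * (L * R + 1) * S) := by ring
        _ = _ := by rw [hR]
  have hL1 : L ≤ 1 := by
    rw [← ENNReal.ofReal_one]
    exact ENNReal.ofReal_le_ofReal hlam1.le
  have hm : (1 : ℝ≥0∞) ≤ m + 1 := le_add_self
  have hLV : L ^ i * V ≤ V * (m + 1) :=
    calc L ^ i * V ≤ 1 * V := by
          gcongr
          exact pow_le_one' hL1 i
      _ = V * 1 := by ring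
      _ ≤ _ := by gcongr
  have hsup' : (⨆ x : Icc (0 : ℝ) 1, (‖(P.transfer m)^[i] φ (x : ℝ)‖₊ : ℝ≥0∞)) ≤
      L ^ (m * i) * S * E := iSup_le fun x => hsup i x x.2
  calc _ ≤ L ^ (m * i) * S * E * 1 + L ^ (m * i) * (L ^ i * V + (m + 1) * K * E * R * S) := by
        rw [mul_one]
        exact add_le_add hsup' (hvar i)
    _ ≤ L ^ (m * i) * S * E * (m + 1) +
          L ^ (m * i) * (V * (m + 1) + (m + 1) * K * E * R * S) := by gcongr
    _ ≤ L ^ (m * i) * S * E * (m + 1) +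
          L ^ (m * i) * (V * (m + 1) + (m + 1) * K * E * R * S) +
          (m + 1) * L ^ (m * i) * (E * V + S + K * E * R * V) := le_self_add
    _ = _ := by ring

/-- Proposition 2.6(b). For a mixing PEUM there are `M̄ > 0` and `λ̄ > 1`
such that for all `i₁,…,i_k ≥ 1`, `m₁ > ⋯ > m_k ≥ 1` and BV functions `h₁,…,h_k`,
`‖𝔇^{i₁,…,i_k}_{m₁,…,m_k}(h₁,…,h_k)‖_BV ≤ M̄ λ̄^{−i₁m₁} ⋯ λ̄^{−i_km_k} ‖h₁‖_BV ⋯ ‖h_k‖_BV`. -/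
theorem Dop_BV_bound (P : PEUM) (ρ : ℝ → ℝ) (θ : ℝ)
    (hρ : P.IsInvariantDensity ρ) (hmix : P.Mixing ρ θ) :
    ∃ M : ℝ, 0 < M ∧ ∃ lam' : ℝ, 1 < lam' ∧
      ∀ l : List (ℕ × ℕ × (ℝ → ℝ)), l ≠ [] →
        (∀ p ∈ l, 1 ≤ p.1 ∧ 1 ≤ p.2.1) →
        l.Chain' (fun p q => q.2.1 < p.2.1) →
        (∀ p ∈ l, bvOn p.2.2) →
        eBVnorm (P.DD l) ≤ ENNReal.ofReal M *
          (l.map fun p => ENNReal.ofReal ((lam' ^ (p.1 * p.2.1))⁻¹)).prod *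
          (l.map fun p => eBVnorm p.2.2).prod := by
  obtain ⟨A, hA0, hA⟩ := hmix.exists_eBVnorm_iterate_transfer_le hρ
  have hsqrt : 1 < √P.lam := Real.lt_sqrt_of_sq_lt (by simpa using P.lam_gt_one)
  set r : ℝ := (√P.lam)⁻¹ with hr
  have hr0 : 0 < r := inv_pos.2 (one_pos.trans hsqrt)
  have hr1 : r < 1 := inv_lt_one_of_one_lt₀ hsqrt
  have hrr : P.lam⁻¹ = r ^ 2 := by rw [hr, inv_pow, Real.sq_sqrt P.lam_pos.le]
  obtain ⟨m₀, hm₀⟩ : ∃ m₀ : ℕ, ∀ m ≥ m₀, A * (m + 1) * r ^ m ≤ 1 := by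
    have h1 := tendsto_self_mul_const_pow_of_lt_one hr0.le hr1
    have h2 := tendsto_pow_atTop_nhds_zero_of_lt_one hr0.le hr1
    have h3 : Tendsto (fun m : ℕ => A * (m * r ^ m + r ^ m)) atTop (𝓝 0) := by
      simpa using (h1.add h2).const_mul A
    obtain ⟨m₀, h⟩ := eventually_atTop.1 (h3.eventually_le_const zero_lt_one)
    exact ⟨m₀, fun m hm => by linarith [h m hm]⟩
  set B : ℝ := A * (m₀ + 1) + 1 with hB
  have hB1 : 1 ≤ B := by
    have : 0 ≤ A * (m₀ + 1) := by positivity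
    linarith
  have hB0 : 0 < B := one_pos.trans_le hB1
  have hstep : ∀ m n : ℕ, m < n →
      A * (m + 1) * r ^ m * B ^ min m m₀ ≤ B ^ min n m₀ := by
    intro m n hmn
    rcases le_or_gt m₀ m with h | h
    · rw [min_eq_right h, min_eq_right (h.trans hmn.le)]
      exact mul_le_of_le_one_left (by positivity) (hm₀ m h)
    · have h1 : A * (m + 1) * r ^ m ≤ B := by
        have h2 : (m : ℝ) ≤ m₀ := by exact_mod_cast h.le
        calc A * (m + 1) * r ^ m ≤ A * (m₀ + 1) * 1 := by
              gcongr
              exact pow_le_one₀ hr0.le hr1.le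
          _ ≤ B := by rw [hB]; linarith
      calc _ ≤ B * B ^ min m m₀ := by gcongr
        _ = B ^ (min m m₀ + 1) := by ring
        _ ≤ _ := pow_le_pow_right₀ hB1 (by omega)
  have hop : ∀ (m i : ℕ), 1 ≤ i → ∀ φ : ℝ → ℝ, eBVnorm ((P.transfer m)^[i] φ) ≤
      ENNReal.ofReal (A * (m + 1) * r ^ m) * ENNReal.ofReal (r ^ (i * m)) * eBVnorm φ := by
    intro m i hi φ
    refine (hA m i φ).trans ?_
    have hc : (m + 1 : ℝ≥0∞) = ENNReal.ofReal (m + 1) := by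
      rw [ENNReal.ofReal_add (by positivity) zero_le_one]
      simp
    rw [hc, ← ENNReal.ofReal_pow (inv_pos.2 P.lam_pos).le, ← ENNReal.ofReal_mul hA0,
      ← ENNReal.ofReal_mul (by positivity), ← ENNReal.ofReal_mul (by positivity)]
    have hpow : P.lam⁻¹ ^ (m * i) ≤ r ^ m * r ^ (i * m) := by
      rw [hrr, ← pow_mul, ← pow_add]
      exact pow_le_pow_of_le_one hr0.le hr1.le (by nlinarith [Nat.mul_le_mul_left m hi])
    rw [mul_assoc (A * (m + 1))]
    gcongr
  have main : ∀ l : List (ℕ × ℕ × (ℝ → ℝ)), (∀ p ∈ l, 1 ≤ p.1) →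
      l.Pairwise (fun p q => q.2.1 < p.2.1) → ∀ n : ℕ, (∀ p ∈ l, p.2.1 < n) →
      eBVnorm (P.DD l) ≤ ENNReal.ofReal (B ^ min n m₀) *
        (l.map fun p => ENNReal.ofReal (r ^ (p.1 * p.2.1))).prod *
        (l.map fun p => eBVnorm p.2.2).prod := by
    intro l
    induction l with
    | nil =>
      intro _ _ n _
      have : (1 : ℝ) ≤ B ^ min n m₀ := one_le_pow₀ hB1
      simpa [PEUM.DD, eBVnorm_one] using this
    | cons p l ih =>
      intro hi hl n hn
      obtain ⟨hpl, hl⟩ := List.pairwise_cons.1 hl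
      have h := ih (fun q hq => hi q (List.mem_cons_of_mem _ hq)) hl p.2.1 hpl
      simp only [List.map_cons, List.prod_cons, PEUM.DD]
      set Q₁ := (l.map fun p => ENNReal.ofReal (r ^ (p.1 * p.2.1))).prod
      set Q₂ := (l.map fun p => eBVnorm p.2.2).prod
      refine (hop p.2.1 p.1 (hi p List.mem_cons_self) _).trans ?_
      calc _ ≤ ENNReal.ofReal (A * (p.2.1 + 1) * r ^ p.2.1) * ENNReal.ofReal (r ^ (p.1 * p.2.1)) *
            (eBVnorm p.2.2 * (ENNReal.ofReal (B ^ min p.2.1 m₀) * Q₁ * Q₂)) := by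
            gcongr
            exact (eBVnorm_mul_le _ _).trans (by gcongr)
        _ = ENNReal.ofReal (A * (p.2.1 + 1) * r ^ p.2.1) * ENNReal.ofReal (B ^ min p.2.1 m₀) *
            (ENNReal.ofReal (r ^ (p.1 * p.2.1)) * Q₁) * (eBVnorm p.2.2 * Q₂) := by ring
        _ ≤ _ := by
            rw [← ENNReal.ofReal_mul (by positivity)]
            gcongr
            exact hstep _ _ (hn p List.mem_cons_self)
  refine ⟨B ^ m₀, by positivity, √P.lam, hsqrt, fun l _ hl hchain _ => ?_⟩
  have : IsTrans (ℕ × ℕ × (ℝ → ℝ)) (fun p q => q.2.1 < p.2.1) := ⟨fun _ _ _ h h' => h'.trans h⟩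
  have h := main l (fun p hp => (hl p hp).1) (List.isChain_iff_pairwise.1 hchain)
    ((l.map fun p => p.2.1).sum + 1)
    fun p hp => Nat.lt_succ_of_le (List.le_sum_of_mem (List.mem_map_of_mem hp))
  simp only [← inv_pow]
  refine h.trans ?_
  gcongr
  exact min_le_right _ _
end

section
/- Let f be a mixing piecewise expanding unimodal map with C² branches and let ρ be the density of its unique absolutely continuous invariant probability measure. There exist constants K ≥ 1, D ≥ 1 and ς < 1 such that for every ε > 0, every n ∈ ℕ and every x̄, x ∈ [0,1]: if |c_j − x̄| > ε for all 1 ≤ j ≤ n and |x − x̄| < ε, then |ρ(x) − ρ(x̄)| ≤ K ε + D ςⁿ. -/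
open MeasureTheory Set Filter Topology Asymptotics
open scoped ENNReal NNReal

theorem exists_measure_eVariationOn_le {φ : ℝ → ℝ} {s : Set ℝ} (hφ : BoundedVariationOn φ s) :
    ∃ N : Measure ℝ, IsLocallyFiniteMeasure N ∧
      ∀ J ⊆ s, J.OrdConnected → eVariationOn φ J ≤ N J := by
  have hfin : ∀ x, eVariationOn φ (s ∩ Iic x) ≠ ∞ := fun x =>
    ne_top_of_le_ne_top hφ (eVariationOn.mono φ inter_subset_left)
  have hg : Monotone fun x : ℝ => (eVariationOn φ (s ∩ Iic x)).toReal := fun x y hxy =>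
    ENNReal.toReal_mono (hfin y)
      (eVariationOn.mono φ (inter_subset_inter_right s (Iic_subset_Iic.2 hxy)))
  refine ⟨hg.stieltjesFunction.measure, inferInstance, fun J hJs hJ => ?_⟩
  refine iSup_le fun p => ?_
  rcases p with ⟨n, u, hu, hus⟩
  have hsub : Icc (u 0) (u n) ⊆ J := hJ.out (hus 0) (hus n)
  have h0n : u 0 ≤ u n := hu (Nat.zero_le n)
  calc ∑ i ∈ Finset.range n, edist (φ (u (i + 1))) (φ (u i))
      ≤ eVariationOn φ (Icc (u 0) (u n)) :=
        eVariationOn.sum_le_of_monotoneOn_Iic (hu.monotoneOn _)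
          fun i hi => ⟨hu (Nat.zero_le i), hu hi⟩
    _ ≤ ENNReal.ofReal ((eVariationOn φ (s ∩ Iic (u n))).toReal
          - (eVariationOn φ (s ∩ Iic (u 0))).toReal) := by
        rw [ENNReal.ofReal_sub _ ENNReal.toReal_nonneg, ENNReal.ofReal_toReal (hfin _),
          ENNReal.ofReal_toReal (hfin _)]
        refine ENNReal.le_sub_of_add_le_left (hfin _) ?_
        refine (eVariationOn.add_le_union φ fun x hx y hy => hx.2.trans hy.1).trans
          (eVariationOn.mono φ ?_)
        rintro x (hx | hx)
        · exact ⟨hx.1, hx.2.trans h0n⟩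
        · exact ⟨hJs (hsub hx), hx.2⟩
    _ ≤ hg.stieltjesFunction.measure (Icc (u 0) (u n)) := by
        rw [StieltjesFunction.measure_Icc]
        refine ENNReal.ofReal_le_ofReal (sub_le_sub ?_ ?_)
        · rw [hg.stieltjesFunction_eq]
          exact hg.le_rightLim le_rfl
        · refine le_of_tendsto (hg.stieltjesFunction.mono.tendsto_leftLim (u 0)) ?_
          filter_upwards [self_mem_nhdsWithin] with z hz
          rw [hg.stieltjesFunction_eq]
          exact hg.rightLim_le hz
    _ ≤ _ := measure_mono hsub

theorem eVariationOn_le_of_edist_le_s14 {φ g : ℝ → ℝ} {J : Set ℝ} (hJ : J.OrdConnected)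
    {μ : Measure ℝ} {a b : ℝ≥0∞}
    (h : ∀ x ∈ J, ∀ y ∈ J, x ≤ y →
      edist (g x) (g y) ≤ a * eVariationOn φ (Icc x y) + b * μ (Ioc x y)) :
    eVariationOn g J ≤ a * eVariationOn φ J + b * μ J := by
  refine iSup_le fun p => ?_
  rcases p with ⟨n, u, hu, hus⟩
  have hsub : Icc (u 0) (u n) ⊆ J := hJ.out (hus 0) (hus n)
  calc ∑ i ∈ Finset.range n, edist (g (u (i + 1))) (g (u i))
      ≤ ∑ i ∈ Finset.range n, (a * eVariationOn φ (Icc (u i) (u (i + 1)))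
          + b * μ (Ioc (u i) (u (i + 1)))) := by
        refine Finset.sum_le_sum fun i _ => ?_
        rw [edist_comm]
        exact h _ (hus _) _ (hus _) (hu (Nat.le_succ i))
    _ = a * eVariationOn φ (Icc (u 0) (u n))
          + b * ∑ i ∈ Finset.range n, μ (Ioc (u i) (u (i + 1))) := by
        rw [Finset.sum_add_distrib, ← Finset.mul_sum, ← Finset.mul_sum,
          eVariationOn.sum' φ hu]
    _ ≤ a * eVariationOn φ J + b * μ J := by
        gcongr
        · exact eVariationOn.mono φ hsub
        · rw [← measure_biUnion_finset (fun i _ j _ hij => ?_) fun i _ => measurableSet_Ioc]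
          · refine measure_mono (iUnion₂_subset fun i hi x hx => hsub ?_)
            exact ⟨(hu (Nat.zero_le i)).trans hx.1.le,
              hx.2.trans (hu (Finset.mem_range.1 hi))⟩
          · exact hu.pairwise_disjoint_on_Ioc_succ hij

theorem eVariationOn_add_le_s14 {u v w : ℝ → ℝ} {J : Set ℝ} (h : ∀ x ∈ J, u x = v x + w x) :
    eVariationOn u J ≤ eVariationOn v J + eVariationOn w J := by
  refine iSup_le fun p => ?_
  rcases p with ⟨n, t, ht, hts⟩
  calc ∑ i ∈ Finset.range n, edist (u (t (i + 1))) (u (t i))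
      ≤ ∑ i ∈ Finset.range n, (edist (v (t (i + 1))) (v (t i))
          + edist (w (t (i + 1))) (w (t i))) := by
        refine Finset.sum_le_sum fun i _ => ?_
        rw [h _ (hts _), h _ (hts _)]
        exact edist_add_add_le _ _ _ _
    _ ≤ _ := by
        rw [Finset.sum_add_distrib]
        exact add_le_add (eVariationOn.sum_le ht hts) (eVariationOn.sum_le ht hts)

/-- The variation of a function carried by an increasing branch `F` is controlled by the
variation of its pull-back, provided the pull-back vanishes where the branch stops inside `J`. -/
theorem eVariationOn_push_le_of_strictMonoOn {F g u : ℝ → ℝ} {p q : ℝ} {J : Set ℝ} (hpq : p ≤ q)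
    (hF : StrictMonoOn F (Icc p q)) (hFc : ContinuousOn F (Icc p q)) (hJ : J.OrdConnected)
    (hp : F p ∈ J → g p = 0) (hq : F q ∈ J → g q = 0)
    (hu : ∀ y ∈ Icc p q, F y ∈ J → u (F y) = g y)
    (hu0 : ∀ x ∈ J, (∀ y ∈ Icc p q, F y ≠ x) → u x = 0) :
    eVariationOn u J ≤ eVariationOn g (Icc p q ∩ F ⁻¹' J) := by
  have hpm : p ∈ Icc p q := left_mem_Icc.2 hpq
  have hqm : q ∈ Icc p q := right_mem_Icc.2 hpq
  rcases (Icc p q ∩ F ⁻¹' J).eq_empty_or_nonempty with he | ⟨y₀, hy₀, hy₀J⟩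
  · have h0 : ∀ x ∈ J, u x = 0 := fun x hx => hu0 x hx fun y hy hyx =>
      (eq_empty_iff_forall_notMem.1 he) y ⟨hy, show F y ∈ J by rwa [hyx]⟩
    rw [eVariationOn.constant_on]
    · exact zero_le
    · rintro _ ⟨x, hx, rfl⟩ _ ⟨y, hy, rfl⟩
      rw [h0 x hx, h0 y hy]
  have hFpq : F p ≤ F q := hF.monotoneOn hpm hqm hpq
  let G := Function.invFunOn F (Icc p q)
  have hex : ∀ x ∈ Icc (F p) (F q), ∃ y ∈ Icc p q, F y = x := fun x hx =>
    intermediate_value_Icc hpq hFc hx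
  have hGm : ∀ x ∈ Icc (F p) (F q), G x ∈ Icc p q := fun x hx =>
    Function.invFunOn_mem (hex x hx)
  have hFG : ∀ x ∈ Icc (F p) (F q), F (G x) = x := fun x hx =>
    Function.invFunOn_eq (hex x hx)
  let κ : ℝ → ℝ := fun x => max (F p) (min (F q) x)
  have hκm : ∀ x, κ x ∈ Icc (F p) (F q) := fun x =>
    ⟨le_max_left _ _, max_le hFpq (min_le_left _ _)⟩
  have hpy : F p ≤ F y₀ := hF.monotoneOn hpm hy₀ hy₀.1
  have hyq : F y₀ ≤ F q := hF.monotoneOn hy₀ hqm hy₀.2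
  have hmono : Monotone (G ∘ κ) := fun x y hxy => by
    refine (hF.le_iff_le (hGm _ (hκm x)) (hGm _ (hκm y))).1 ?_
    rw [hFG _ (hκm x), hFG _ (hκm y)]
    exact max_le_max le_rfl (min_le_min le_rfl hxy)
  have hcases : ∀ x ∈ J, κ x ∈ J ∧ u x = g (G (κ x)) := by
    intro x hx
    rcases lt_or_ge x (F p) with h1 | h1
    · have hk : κ x = F p := max_eq_left ((min_le_right _ _).trans h1.le)
      have hpJ : F p ∈ J := hJ.out hx hy₀J ⟨h1.le, hpy⟩
      have hG : G (F p) = p :=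
        hF.injOn (hGm _ ⟨le_rfl, hFpq⟩) hpm (hFG _ ⟨le_rfl, hFpq⟩)
      rw [hk, hG, hp hpJ]
      exact ⟨hpJ, hu0 x hx fun y hy hyx =>
        absurd (hF.monotoneOn hpm hy hy.1) (by rw [hyx]; exact h1.not_ge)⟩
    rcases lt_or_ge (F q) x with h2 | h2
    · have hk : κ x = F q := by simp only [κ]; rw [min_eq_left h2.le, max_eq_right hFpq]
      have hqJ : F q ∈ J := hJ.out hy₀J hx ⟨hyq, h2.le⟩
      have hG : G (F q) = q :=
        hF.injOn (hGm _ ⟨hFpq, le_rfl⟩) hqm (hFG _ ⟨hFpq, le_rfl⟩)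
      rw [hk, hG, hq hqJ]
      exact ⟨hqJ, hu0 x hx fun y hy hyx =>
        absurd (hF.monotoneOn hy hqm hy.2) (by rw [hyx]; exact h2.not_ge)⟩
    · have hk : κ x = x := by simp only [κ]; rw [min_eq_right h2, max_eq_right h1]
      rw [hk]
      refine ⟨hx, ?_⟩
      have := hu (G x) (hGm x ⟨h1, h2⟩) (by rwa [hFG x ⟨h1, h2⟩])
      rwa [hFG x ⟨h1, h2⟩] at this
  rw [eVariationOn.congr (g := g ∘ (G ∘ κ)) fun x hx => (hcases x hx).2]
  refine eVariationOn.comp_le_of_monotoneOn g _ (hmono.monotoneOn J) fun x hx =>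
    ⟨hGm _ (hκm x), ?_⟩
  change F (G (κ x)) ∈ J
  rw [hFG _ (hκm x)]
  exact (hcases x hx).1

theorem eVariationOn_push_le_of_strictAntiOn {F g u : ℝ → ℝ} {p q : ℝ} {J : Set ℝ} (hpq : p ≤ q)
    (hF : StrictAntiOn F (Icc p q)) (hFc : ContinuousOn F (Icc p q)) (hJ : J.OrdConnected)
    (hp : F p ∈ J → g p = 0) (hq : F q ∈ J → g q = 0)
    (hu : ∀ y ∈ Icc p q, F y ∈ J → u (F y) = g y)
    (hu0 : ∀ x ∈ J, (∀ y ∈ Icc p q, F y ≠ x) → u x = 0) :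
    eVariationOn u J ≤ eVariationOn g (Icc p q ∩ F ⁻¹' J) := by
  have hneg : ∀ y ∈ Icc (-q) (-p), -y ∈ Icc p q := fun y hy =>
    ⟨by linarith [hy.2], by linarith [hy.1]⟩
  refine (eVariationOn_push_le_of_strictMonoOn (F := fun y => F (-y)) (g := g ∘ Neg.neg)
    (p := -q) (q := -p) (neg_le_neg hpq)
    (fun x hx y hy hxy => hF (hneg y hy) (hneg x hx) (neg_lt_neg hxy))
    (hFc.comp continuous_neg.continuousOn hneg) hJ (by simpa using hq) (by simpa using hp)
    (fun y hy => hu (-y) (hneg y hy)) fun x hx h => hu0 x hx fun y hy => ?_).trans ?_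
  · simpa using h (-y) ⟨neg_le_neg hy.2, neg_le_neg hy.1⟩
  · exact eVariationOn.comp_le_of_antitoneOn g _ (fun x _ y _ h => neg_le_neg h)
      fun y hy => ⟨hneg y hy.1, hy.2⟩

theorem eVariationOn_div_abs_le {φ D g : ℝ → ℝ} {K : Set ℝ} {lam δ : ℝ} {L : ℝ≥0}
    (hK : K.OrdConnected) (hφ : ∀ x, 0 ≤ φ x) (hlam : 1 < lam) (hD : ∀ y ∈ K, lam ≤ |D y|)
    (hL : LipschitzOnWith L D K) (hδ : ∀ x ∈ K, ∀ y ∈ K, |x - y| ≤ δ)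
    (hg : ∀ y ∈ K, g y = φ y / |D y|) :
    eVariationOn g K ≤ (ENNReal.ofReal lam⁻¹ + L * ENNReal.ofReal δ) * eVariationOn φ K
      + L * volume.withDensity (fun x => ENNReal.ofReal (φ x)) K := by
  refine eVariationOn_le_of_edist_le_s14 hK fun x hx y hy hxy => ?_
  have hreal : |g x - g y| ≤ lam⁻¹ * |φ x - φ y| + L * (φ x * (y - x)) := by
    have hx1 := hD x hx
    have hy1 := hD y hy
    have hx0 : 0 < |D x| := by linarith
    have hy0 : 0 < |D y| := by linarith
    have h1 : g x - g y = (φ x - φ y) / |D y| + φ x * (|D y| - |D x|) / (|D x| * |D y|) := by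
      rw [hg x hx, hg y hy]
      field_simp
      ring
    have h2 : |((φ x - φ y) / |D y|)| ≤ lam⁻¹ * |φ x - φ y| := by
      rw [abs_div, abs_abs, div_eq_inv_mul]
      gcongr
    have hLip : |(|D y| - |D x|)| ≤ L * (y - x) := by
      refine (abs_abs_sub_abs_le_abs_sub _ _).trans ?_
      have := hL.dist_le_mul y hy x hx
      rwa [Real.dist_eq, Real.dist_eq, abs_of_nonneg (sub_nonneg.2 hxy)] at this
    have h3 : |(φ x * (|D y| - |D x|) / (|D x| * |D y|))| ≤ L * (φ x * (y - x)) := by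
      rw [abs_div, abs_mul, abs_of_nonneg (hφ x), abs_mul, abs_abs, abs_abs]
      refine (div_le_self (by positivity [hφ x]) ?_).trans ?_
      · nlinarith
      · calc φ x * |(|D y| - |D x|)| ≤ φ x * (L * (y - x)) :=
              mul_le_mul_of_nonneg_left hLip (hφ x)
          _ = _ := by ring
    rw [h1]
    exact (abs_add_le _ _).trans (add_le_add h2 h3)
  have hsub : Icc x y ⊆ K := hK.out hx hy
  have hint : ENNReal.ofReal (φ x * (y - x)) ≤
      volume.withDensity (fun x => ENNReal.ofReal (φ x)) (Ioc x y)
        + eVariationOn φ (Icc x y) * ENNReal.ofReal δ := by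
    rw [withDensity_apply _ measurableSet_Ioc, ENNReal.ofReal_mul (hφ x), ← Real.volume_Ioc,
      ← setLIntegral_const]
    calc ∫⁻ _ in Ioc x y, ENNReal.ofReal (φ x)
        ≤ ∫⁻ t in Ioc x y, (ENNReal.ofReal (φ t) + eVariationOn φ (Icc x y)) := by
          refine setLIntegral_mono' measurableSet_Ioc fun t ht => ?_
          have h1 : φ x ≤ φ t + |φ x - φ t| := by linarith [le_abs_self (φ x - φ t)]
          refine (ENNReal.ofReal_le_ofReal h1).trans ?_
          rw [ENNReal.ofReal_add (hφ t) (abs_nonneg _), ← Real.dist_eq, ← edist_dist]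
          exact add_le_add le_rfl
            (eVariationOn.edist_le φ (left_mem_Icc.2 hxy) (Ioc_subset_Icc_self ht))
      _ = (∫⁻ t in Ioc x y, ENNReal.ofReal (φ t))
            + eVariationOn φ (Icc x y) * ENNReal.ofReal (y - x) := by
          rw [lintegral_add_right _ measurable_const, setLIntegral_const, Real.volume_Ioc]
      _ ≤ _ := by
          gcongr
          refine (le_abs_self _).trans (hδ y hy x hx)
  calc edist (g x) (g y) = ENNReal.ofReal |g x - g y| := by rw [edist_dist, Real.dist_eq]
    _ ≤ ENNReal.ofReal (lam⁻¹ * |φ x - φ y| + L * (φ x * (y - x))) :=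
        ENNReal.ofReal_le_ofReal hreal
    _ = ENNReal.ofReal lam⁻¹ * edist (φ x) (φ y) + L * ENNReal.ofReal (φ x * (y - x)) := by
        have h0 : 0 ≤ φ x * (y - x) := mul_nonneg (hφ x) (sub_nonneg.2 hxy)
        rw [ENNReal.ofReal_add (by positivity) (by positivity),
          ENNReal.ofReal_mul (by positivity), ENNReal.ofReal_mul (by positivity),
          ENNReal.ofReal_coe_nnreal, edist_dist, Real.dist_eq]
    _ ≤ ENNReal.ofReal lam⁻¹ * eVariationOn φ (Icc x y)
          + L * (volume.withDensity (fun x => ENNReal.ofReal (φ x)) (Ioc x y)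
            + eVariationOn φ (Icc x y) * ENNReal.ofReal δ) := by
        gcongr
        exact eVariationOn.edist_le φ (left_mem_Icc.2 hxy) (right_mem_Icc.2 hxy)
    _ = _ := by ring

section Branch

variable {F : ℝ → ℝ} {a b lam : ℝ}

theorem hasDerivAt_of_expanding (hlam : 0 < lam) (he : ∀ x ∈ Icc a b, lam ≤ |deriv F x|)
    {x : ℝ} (hx : x ∈ Icc a b) : HasDerivAt F (deriv F x) x := by
  refine (differentiableAt_of_deriv_ne_zero fun h => ?_).hasDerivAt
  have := he x hx
  rw [h, abs_zero] at this
  exact hlam.not_ge this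

theorem deriv_neg_or_pos_of_expanding (hlam : 0 < lam) (he : ∀ x ∈ Icc a b, lam ≤ |deriv F x|) :
    (∀ x ∈ Icc a b, deriv F x < 0) ∨ ∀ x ∈ Icc a b, 0 < deriv F x := by
  refine hasDerivWithinAt_forall_lt_or_forall_gt_of_forall_ne (convex_Icc a b)
    (fun x hx => (hasDerivAt_of_expanding hlam he hx).hasDerivWithinAt) fun x hx h => ?_
  have := he x hx
  rw [h, abs_zero] at this
  exact hlam.not_ge this

theorem exists_lipschitzOnWith_deriv (hab : a < b) (hF : ContDiffOn ℝ 2 F (Icc a b))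
    (hlam : 0 < lam) (he : ∀ x ∈ Icc a b, lam ≤ |deriv F x|) :
    ∃ L : ℝ≥0, LipschitzOnWith L (deriv F) (Icc a b) := by
  have h1 : ContDiffOn ℝ 1 (derivWithin F (Icc a b)) (Icc a b) :=
    hF.derivWithin (uniqueDiffOn_Icc hab) (by norm_num)
  have h2 : ContDiffOn ℝ 1 (deriv F) (Icc a b) := h1.congr fun x hx =>
    ((hasDerivAt_of_expanding hlam he hx).hasDerivWithinAt.derivWithin
      (uniqueDiffOn_Icc hab x hx)).symm
  exact h2.exists_lipschitzOnWith one_ne_zero (convex_Icc a b) isCompact_Icc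

theorem mul_abs_sub_le_of_expanding (hlam : 0 < lam) (he : ∀ x ∈ Icc a b, lam ≤ |deriv F x|)
    {x y : ℝ} (hx : x ∈ Icc a b) (hy : y ∈ Icc a b) : lam * |x - y| ≤ |F x - F y| := by
  wlog hxy : x < y generalizing x y
  · rcases (not_lt.1 hxy).eq_or_lt with h | h
    · simp [h]
    · rw [abs_sub_comm x, abs_sub_comm (F x)]
      exact this hy hx h
  have hsub : Icc x y ⊆ Icc a b := Icc_subset_Icc hx.1 hy.2
  obtain ⟨z, hz, hzs⟩ := exists_hasDerivAt_eq_slope F (deriv F) hxy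
    (fun t ht => (hasDerivAt_of_expanding hlam he (hsub ht)).continuousAt.continuousWithinAt)
    fun t ht => hasDerivAt_of_expanding hlam he (hsub (Ioo_subset_Icc_self ht))
  have h := he z (hsub (Ioo_subset_Icc_self hz))
  rw [hzs, abs_div, le_div_iff₀ (abs_pos.2 (sub_pos.2 hxy).ne')] at h
  rwa [abs_sub_comm x, abs_sub_comm (F x)]

end Branch

namespace PEUM

variable (P : PEUM)

theorem Icc_left_subset : Icc 0 P.c ⊆ Icc 0 (P.c + P.eps) :=
  Icc_subset_Icc_right (by linarith [P.eps_pos])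

theorem Icc_right_subset : Icc P.c 1 ⊆ Icc (P.c - P.eps) 1 :=
  Icc_subset_Icc_left (by linarith [P.eps_pos])

theorem hasDerivAt_left {x : ℝ} (hx : x ∈ Icc 0 P.c) : HasDerivAt P.f₁ (deriv P.f₁ x) x :=
  hasDerivAt_of_expanding P.lam_pos P.expand₁ (P.Icc_left_subset hx)

theorem hasDerivAt_right {x : ℝ} (hx : x ∈ Icc P.c 1) : HasDerivAt P.f₂ (deriv P.f₂ x) x :=
  hasDerivAt_of_expanding P.lam_pos P.expand₂ (P.Icc_right_subset hx)

theorem continuousOn : ContinuousOn P.f (Icc 0 1) := by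
  rw [← Icc_union_Icc_eq_Icc P.c_mem.1.le P.c_mem.2.le]
  exact P.continuousOn_left.union_of_isClosed P.continuousOn_right isClosed_Icc isClosed_Icc

theorem expanding_left {x y : ℝ} (hx : x ∈ Icc 0 P.c) (hy : y ∈ Icc 0 P.c) :
    P.lam * |x - y| ≤ |P.f x - P.f y| := by
  rw [P.eqOn_left hx, P.eqOn_left hy]
  exact mul_abs_sub_le_of_expanding P.lam_pos P.expand₁ (P.Icc_left_subset hx)
    (P.Icc_left_subset hy)

theorem expanding_right {x y : ℝ} (hx : x ∈ Icc P.c 1) (hy : y ∈ Icc P.c 1) :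
    P.lam * |x - y| ≤ |P.f x - P.f y| := by
  rw [P.eqOn_right hx, P.eqOn_right hy]
  exact mul_abs_sub_le_of_expanding P.lam_pos P.expand₂ (P.Icc_right_subset hx)
    (P.Icc_right_subset hy)

theorem strictMonoOn_left (h : ∀ x ∈ Icc 0 (P.c + P.eps), 0 < deriv P.f₁ x) :
    StrictMonoOn P.f (Icc 0 P.c) := by
  refine StrictMonoOn.congr (strictMonoOn_of_deriv_pos (convex_Icc 0 P.c) ?_ fun x hx =>
    h x (P.Icc_left_subset (interior_subset hx))) P.eqOn_left.symm
  exact fun x hx => (P.hasDerivAt_left hx).continuousAt.continuousWithinAt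

theorem strictAntiOn_left (h : ∀ x ∈ Icc 0 (P.c + P.eps), deriv P.f₁ x < 0) :
    StrictAntiOn P.f (Icc 0 P.c) := by
  refine StrictAntiOn.congr (strictAntiOn_of_deriv_neg (convex_Icc 0 P.c) ?_ fun x hx =>
    h x (P.Icc_left_subset (interior_subset hx))) P.eqOn_left.symm
  exact fun x hx => (P.hasDerivAt_left hx).continuousAt.continuousWithinAt

theorem strictMonoOn_right (h : ∀ x ∈ Icc (P.c - P.eps) 1, 0 < deriv P.f₂ x) :
    StrictMonoOn P.f (Icc P.c 1) := by
  refine StrictMonoOn.congr (strictMonoOn_of_deriv_pos (convex_Icc P.c 1) ?_ fun x hx =>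
    h x (P.Icc_right_subset (interior_subset hx))) P.eqOn_right.symm
  exact fun x hx => (P.hasDerivAt_right hx).continuousAt.continuousWithinAt

theorem strictAntiOn_right (h : ∀ x ∈ Icc (P.c - P.eps) 1, deriv P.f₂ x < 0) :
    StrictAntiOn P.f (Icc P.c 1) := by
  refine StrictAntiOn.congr (strictAntiOn_of_deriv_neg (convex_Icc P.c 1) ?_ fun x hx =>
    h x (P.Icc_right_subset (interior_subset hx))) P.eqOn_right.symm
  exact fun x hx => (P.hasDerivAt_right hx).continuousAt.continuousWithinAt

theorem strictMonoOn_or_strictAntiOn_left :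
    StrictMonoOn P.f (Icc 0 P.c) ∨ StrictAntiOn P.f (Icc 0 P.c) :=
  (deriv_neg_or_pos_of_expanding P.lam_pos P.expand₁).symm.imp P.strictMonoOn_left
    P.strictAntiOn_left

theorem strictMonoOn_or_strictAntiOn_right :
    StrictMonoOn P.f (Icc P.c 1) ∨ StrictAntiOn P.f (Icc P.c 1) :=
  (deriv_neg_or_pos_of_expanding P.lam_pos P.expand₂).symm.imp P.strictMonoOn_right
    P.strictAntiOn_right

theorem deriv_eq_left {x : ℝ} (hx : x ∈ Icc 0 P.c) (h : DifferentiableAt ℝ P.f x) :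
    deriv P.f x = deriv P.f₁ x :=
  (uniqueDiffOn_Icc P.c_mem.1 x hx).eq_deriv _ h.hasDerivAt.hasDerivWithinAt
    ((P.hasDerivAt_left hx).hasDerivWithinAt.congr_of_mem P.eqOn_left hx)

theorem deriv_eq_right {x : ℝ} (hx : x ∈ Icc P.c 1) (h : DifferentiableAt ℝ P.f x) :
    deriv P.f x = deriv P.f₂ x :=
  (uniqueDiffOn_Icc P.c_mem.2 x hx).eq_deriv _ h.hasDerivAt.hasDerivWithinAt
    ((P.hasDerivAt_right hx).hasDerivWithinAt.congr_of_mem P.eqOn_right hx)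

theorem differentiableAt_of_mem_Ioo_left {x : ℝ} (hx : x ∈ Ioo 0 P.c) :
    DifferentiableAt ℝ P.f x :=
  (P.hasDerivAt_left (Ioo_subset_Icc_self hx)).differentiableAt.congr_of_eventuallyEq <| by
    filter_upwards [Ioo_mem_nhds hx.1 hx.2] with y hy
    exact P.eqOn_left (Ioo_subset_Icc_self hy)

theorem differentiableAt_of_mem_Ioo_right {x : ℝ} (hx : x ∈ Ioo P.c 1) :
    DifferentiableAt ℝ P.f x :=
  (P.hasDerivAt_right (Ioo_subset_Icc_self hx)).differentiableAt.congr_of_eventuallyEq <| by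
    filter_upwards [Ioo_mem_nhds hx.1 hx.2] with y hy
    exact P.eqOn_right (Ioo_subset_Icc_self hy)

theorem inv_abs_deriv_le {x : ℝ} (hx : x ∈ Icc (0 : ℝ) 1) : |deriv P.f x|⁻¹ ≤ P.lam⁻¹ := by
  by_cases hd : DifferentiableAt ℝ P.f x
  · refine inv_anti₀ P.lam_pos ?_
    rcases le_total x P.c with h | h
    · rw [P.deriv_eq_left ⟨hx.1, h⟩ hd]
      exact P.expand₁ x (P.Icc_left_subset ⟨hx.1, h⟩)
    · rw [P.deriv_eq_right ⟨h, hx.2⟩ hd]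
      exact P.expand₂ x (P.Icc_right_subset ⟨h, hx.2⟩)
  · rw [deriv_zero_of_not_differentiableAt hd]
    simpa using P.lam_pos.le

theorem deriv_critical : deriv P.f P.c = 0 := by
  refine deriv_zero_of_not_differentiableAt fun hd => ?_
  have h0 : (0 : ℝ) ∈ Icc 0 P.c := left_mem_Icc.2 P.c_mem.1.le
  have hc : P.c ∈ Icc 0 P.c := right_mem_Icc.2 P.c_mem.1.le
  have hc' : P.c ∈ Icc P.c 1 := left_mem_Icc.2 P.c_mem.2.le
  have h1 : (1 : ℝ) ∈ Icc P.c 1 := right_mem_Icc.2 P.c_mem.2.le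
  have heq : deriv P.f₁ P.c = deriv P.f₂ P.c :=
    (P.deriv_eq_left hc hd).symm.trans (P.deriv_eq_right hc' hd)
  have e1 := P.expanding_left hc h0
  have e2 := P.expanding_right h1 hc'
  rw [sub_zero, abs_of_pos P.c_mem.1] at e1
  rw [abs_of_pos (sub_pos.2 P.c_mem.2)] at e2
  have m0 := P.mapsTo (show (0 : ℝ) ∈ Icc (0 : ℝ) 1 by simp)
  have m1 := P.mapsTo (show (1 : ℝ) ∈ Icc (0 : ℝ) 1 by simp)
  have hlam := P.lam_gt_one
  rcases deriv_neg_or_pos_of_expanding P.lam_pos P.expand₁ with hl | hl <;>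
    rcases deriv_neg_or_pos_of_expanding P.lam_pos P.expand₂ with hr | hr
  · have a1 := P.strictAntiOn_left hl h0 hc P.c_mem.1
    have a2 := P.strictAntiOn_right hr hc' h1 P.c_mem.2
    rw [abs_of_neg (by linarith)] at e1 e2
    nlinarith [m0.2, m1.1]
  · linarith [hl _ (P.Icc_left_subset hc), hr _ (P.Icc_right_subset hc')]
  · linarith [hl _ (P.Icc_left_subset hc), hr _ (P.Icc_right_subset hc')]
  · have a1 := P.strictMonoOn_left hl h0 hc P.c_mem.1
    have a2 := P.strictMonoOn_right hr hc' h1 P.c_mem.2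
    rw [abs_of_pos (by linarith)] at e1 e2
    nlinarith [m0.1, m1.2]

end PEUM

/-- The sum of `t` over the preimages of a point under `F` lying in `s`. -/
noncomputable def preimageSum (F t : ℝ → ℝ) (s : Set ℝ) (x : ℝ) : ℝ :=
  ∑' y : {y : ℝ | y ∈ s ∧ F y = x}, t y

section PreimageSum

variable {F t : ℝ → ℝ} {s : Set ℝ}

theorem preimageSum_apply (hF : InjOn F s) {y : ℝ} (hy : y ∈ s) :
    preimageSum F t s (F y) = t y := by
  have h : {z : ℝ | z ∈ s ∧ F z = F y} = {y} := by
    ext z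
    exact ⟨fun hz => hF hz.1 hy hz.2, fun hz => by rw [mem_singleton_iff.1 hz]; exact ⟨hy, rfl⟩⟩
  exact (tsum_congr_set_coe t h).trans (tsum_singleton y t)

theorem preimageSum_eq_zero {x : ℝ} (h : ∀ y ∈ s, F y ≠ x) : preimageSum F t s x = 0 := by
  have h' : {z : ℝ | z ∈ s ∧ F z = x} = ∅ :=
    eq_empty_of_forall_notMem fun z hz => h z hz.1 hz.2
  exact (tsum_congr_set_coe t h').trans tsum_empty

theorem summable_indicator_preimage (hF : InjOn F s) (x : ℝ) :
    Summable ({y : ℝ | y ∈ s ∧ F y = x}.indicator t) := by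
  have hfin : {y : ℝ | y ∈ s ∧ F y = x}.Finite :=
    Set.Subsingleton.finite fun y hy z hz => hF hy.1 hz.1 (hy.2.trans hz.2.symm)
  exact summable_of_hasFiniteSupport (hfin.subset support_indicator_subset)

end PreimageSum

theorem eVariationOn_preimageSum_le {F t : ℝ → ℝ} {p q : ℝ} {J : Set ℝ} (hpq : p ≤ q)
    (hF : StrictMonoOn F (Icc p q) ∨ StrictAntiOn F (Icc p q)) (hFc : ContinuousOn F (Icc p q))
    (hJ : J.OrdConnected) (hp : F p ∈ J → t p = 0) (hq : F q ∈ J → t q = 0) :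
    eVariationOn (preimageSum F t (Icc p q)) J ≤ eVariationOn t (Icc p q ∩ F ⁻¹' J) := by
  rcases hF with hF | hF
  · exact eVariationOn_push_le_of_strictMonoOn hpq hF hFc hJ hp hq
      (fun y hy _ => preimageSum_apply hF.injOn hy) fun x _ h => preimageSum_eq_zero h
  · exact eVariationOn_push_le_of_strictAntiOn hpq hF hFc hJ hp hq
      (fun y hy _ => preimageSum_apply hF.injOn hy) fun x _ h => preimageSum_eq_zero h

theorem ordConnected_inter_preimage {F : ℝ → ℝ} {p q : ℝ} {J : Set ℝ}
    (hF : StrictMonoOn F (Icc p q) ∨ StrictAntiOn F (Icc p q)) (hJ : J.OrdConnected) :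
    (Icc p q ∩ F ⁻¹' J).OrdConnected := by
  refine ⟨fun x hx y hy z hz => ?_⟩
  have hzm : z ∈ Icc p q := ⟨hx.1.1.trans hz.1, hz.2.trans hy.1.2⟩
  refine ⟨hzm, ?_⟩
  rcases hF with hF | hF
  · exact hJ.out hx.2 hy.2 ⟨hF.monotoneOn hx.1 hzm hz.1, hF.monotoneOn hzm hy.1 hz.2⟩
  · exact hJ.out hy.2 hx.2 ⟨hF.antitoneOn hzm hy.1 hz.2, hF.antitoneOn hx.1 hzm hz.1⟩

theorem ContinuousOn.measurableSet_inter_preimage {F : ℝ → ℝ} {s K : Set ℝ}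
    (hF : ContinuousOn F s) (hs : MeasurableSet s) (hK : MeasurableSet K) :
    MeasurableSet (s ∩ F ⁻¹' K) := by
  have h := hs.subtype_image (hF.domRestrict.measurable hK)
  convert h using 1
  ext x
  simp [and_comm]

namespace PEUM

variable (P : PEUM)

theorem Icc_zero_c_subset : Icc 0 P.c ⊆ Icc (0 : ℝ) 1 := Icc_subset_Icc_right P.c_mem.2.le

theorem Icc_c_one_subset : Icc P.c 1 ⊆ Icc (0 : ℝ) 1 := Icc_subset_Icc_left P.c_mem.1.le

theorem apply_mem_Ioo {y : ℝ} (hy : y ∈ Ioo (0 : ℝ) 1) (hyc : y ≠ P.c) :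
    P.f y ∈ Ioo (0 : ℝ) 1 := by
  have hb : ∀ p q : ℝ, p ∈ Icc (0 : ℝ) 1 → q ∈ Icc (0 : ℝ) 1 → y ∈ Ioo p q →
      (StrictMonoOn P.f (Icc p q) ∨ StrictAntiOn P.f (Icc p q)) → P.f y ∈ Ioo (0 : ℝ) 1 := by
    intro p q hp hq hypq h
    have hpq : p ≤ q := hypq.1.le.trans hypq.2.le
    have hpm : p ∈ Icc p q := left_mem_Icc.2 hpq
    have hqm : q ∈ Icc p q := right_mem_Icc.2 hpq
    have hym : y ∈ Icc p q := Ioo_subset_Icc_self hypq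
    rcases h with h | h
    · exact ⟨(P.mapsTo hp).1.trans_lt (h hpm hym hypq.1),
        (h hym hqm hypq.2).trans_le (P.mapsTo hq).2⟩
    · exact ⟨(P.mapsTo hq).1.trans_lt (h hym hqm hypq.2),
        (h hpm hym hypq.1).trans_le (P.mapsTo hp).2⟩
  have hc := Ioo_subset_Icc_self P.c_mem
  rcases lt_or_gt_of_ne hyc with h | h
  · exact hb 0 P.c (by simp) hc ⟨hy.1, h⟩ P.strictMonoOn_or_strictAntiOn_left
  · exact hb P.c 1 hc (by simp) ⟨h, hy.2⟩ P.strictMonoOn_or_strictAntiOn_right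

/-- The summand of the Perron–Frobenius operator. -/
noncomputable def weighted (φ : ℝ → ℝ) (y : ℝ) : ℝ := φ y / |deriv P.f y|

theorem PF_apply_s14 (φ : ℝ → ℝ) (x : ℝ) :
    P.PF φ x = preimageSum P.f (P.weighted φ) (Icc 0 1) x := by
  simp only [PF, transfer, preimageSum, weighted, pow_zero, one_mul]
  rfl

theorem weighted_le {φ : ℝ → ℝ} (hφ : ∀ x, 0 ≤ φ x) {y : ℝ} (hy : y ∈ Icc (0 : ℝ) 1) :
    P.weighted φ y ≤ P.lam⁻¹ * φ y := by
  rw [weighted, div_eq_mul_inv, mul_comm]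
  exact mul_le_mul_of_nonneg_right (P.inv_abs_deriv_le hy) (hφ y)

theorem PF_eq_add (φ : ℝ → ℝ) {x : ℝ} (hx : x ≠ P.f P.c) :
    P.PF φ x = preimageSum P.f (P.weighted φ) (Icc 0 P.c) x
      + preimageSum P.f (P.weighted φ) (Icc P.c 1) x := by
  have hl : InjOn P.f (Icc 0 P.c) :=
    P.strictMonoOn_or_strictAntiOn_left.elim (fun h => h.injOn) fun h => h.injOn
  have hr : InjOn P.f (Icc P.c 1) :=
    P.strictMonoOn_or_strictAntiOn_right.elim (fun h => h.injOn) fun h => h.injOn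
  rw [PF_apply_s14]
  simp only [preimageSum]
  rw [tsum_subtype, tsum_subtype, tsum_subtype, ← (summable_indicator_preimage hl x).tsum_add
    (summable_indicator_preimage hr x)]
  refine tsum_congr fun y => ?_
  rw [← Icc_union_Icc_eq_Icc P.c_mem.1.le P.c_mem.2.le]
  have hu : {y : ℝ | y ∈ Icc 0 P.c ∪ Icc P.c 1 ∧ P.f y = x}
      = {y : ℝ | y ∈ Icc 0 P.c ∧ P.f y = x} ∪ {y : ℝ | y ∈ Icc P.c 1 ∧ P.f y = x} := by
    ext z
    simp only [mem_ofPred_eq, mem_union]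
    tauto
  rw [hu, indicator_union_of_disjoint]
  refine disjoint_left.2 fun z hz hz' => hx ?_
  rw [← hz.2, le_antisymm hz.1.2 hz'.1.1]

variable {P} {ρ : ℝ → ℝ}

/-- The invariant density vanishes at the endpoints: a preimage of an endpoint is an endpoint or
the critical point, where the weight is zero. -/
theorem IsInvariantDensity.eq_zero (hρ : P.IsInvariantDensity ρ) : ρ 0 = 0 ∧ ρ 1 = 0 := by
  obtain ⟨-, hnn, -, -, hfix⟩ := hρ
  set t := P.weighted ρ with ht
  let S : ℝ → Set ℝ := fun x => {y | y ∈ Icc (0 : ℝ) 1 ∧ P.f y = x}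
  have hsum : ∀ e : ℝ, e ∈ ({0, 1} : Set ℝ) → ρ e = ∑ y ∈ {0, P.c, 1}, (S e).indicator t y := by
    intro e he
    have heI : e ∈ Icc (0 : ℝ) 1 := by rcases he with rfl | rfl <;> simp
    rw [← hfix e heI, PF_apply_s14, preimageSum, tsum_subtype]
    refine tsum_eq_sum fun y hy => indicator_of_notMem (fun hyS => hy ?_) _
    by_contra hne
    simp only [Finset.mem_insert, Finset.mem_singleton, not_or] at hne
    have hm := P.apply_mem_Ioo ⟨lt_of_le_of_ne hyS.1.1 (Ne.symm hne.1),
      lt_of_le_of_ne hyS.1.2 hne.2.2⟩ hne.2.1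
    rw [hyS.2] at hm
    rcases he with rfl | rfl
    · exact hm.1.ne rfl
    · exact hm.2.ne rfl
  have htnn : ∀ y, 0 ≤ t y := fun y => div_nonneg (hnn y) (abs_nonneg _)
  have hle : ∀ y, (S 0).indicator t y + (S 1).indicator t y ≤ t y := by
    intro y
    by_cases h0 : y ∈ S 0
    · have h1 : y ∉ S 1 := fun h => zero_ne_one (h0.2.symm.trans h.2)
      simp [h0, h1]
    · by_cases h1 : y ∈ S 1 <;> simp [h0, h1, htnn]
  have htc : t P.c = 0 := by simp [ht, weighted, P.deriv_critical]
  have hc := P.c_mem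
  have h01 : ρ 0 + ρ 1 ≤ P.lam⁻¹ * (ρ 0 + ρ 1) := by
    calc ρ 0 + ρ 1 = ∑ y ∈ {0, P.c, 1}, ((S 0).indicator t y + (S 1).indicator t y) := by
          rw [Finset.sum_add_distrib, ← hsum 0 (by simp), ← hsum 1 (by simp)]
      _ ≤ ∑ y ∈ {0, P.c, 1}, t y := Finset.sum_le_sum fun y _ => hle y
      _ = t 0 + t 1 := by
          rw [Finset.sum_insert, Finset.sum_insert, Finset.sum_singleton, htc, zero_add]
          · simpa using hc.2.ne
          · simpa using hc.1.ne
      _ ≤ P.lam⁻¹ * ρ 0 + P.lam⁻¹ * ρ 1 :=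
          add_le_add (P.weighted_le hnn (by simp)) (P.weighted_le hnn (by simp))
      _ = _ := by ring
  have hlam : P.lam⁻¹ < 1 := inv_lt_one_of_one_lt₀ P.lam_gt_one
  have h0 := hnn 0
  have h1 := hnn 1
  constructor <;> nlinarith

theorem invMeasure_apply {A : Set ℝ} (hA : MeasurableSet A) (hA01 : A ⊆ Icc (0 : ℝ) 1) :
    P.invMeasure ρ A = volume.withDensity (fun x => ENNReal.ofReal (ρ x)) A := by
  rw [invMeasure, withDensity_apply _ hA, withDensity_apply _ hA, Measure.restrict_restrict hA,
    inter_eq_left.2 hA01]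

theorem IsInvariantDensity.invMeasure_preimage (hρ : P.IsInvariantDensity ρ) {A : Set ℝ}
    (hA : MeasurableSet A) : P.invMeasure ρ (P.f ⁻¹' A) = P.invMeasure ρ A := by
  have hae : AEMeasurable P.f (P.invMeasure ρ) :=
    (P.continuousOn.aemeasurable measurableSet_Icc).mono_ac (withDensity_absolutelyContinuous _ _)
  rw [← Measure.map_apply_of_aemeasurable hae hA, hρ.2.2.2.1]

theorem IsInvariantDensity.invMeasure_branch_preimages_le (hρ : P.IsInvariantDensity ρ)
    {J : Set ℝ} (hJ : J.OrdConnected) (hcJ : P.f P.c ∉ J) :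
    P.invMeasure ρ (Icc 0 P.c ∩ P.f ⁻¹' J) + P.invMeasure ρ (Icc P.c 1 ∩ P.f ⁻¹' J)
      ≤ P.invMeasure ρ J := by
  rw [← hρ.invMeasure_preimage hJ.measurableSet, ← measure_union ?_
    (ordConnected_inter_preimage P.strictMonoOn_or_strictAntiOn_right hJ).measurableSet]
  · exact measure_mono (union_subset inter_subset_right inter_subset_right)
  · exact disjoint_left.2 fun y hy hy' => hcJ (le_antisymm hy.1.2 hy'.1.1 ▸ hy.2)

theorem abs_sub_le_of_mem_preimage {p q δ : ℝ} {J : Set ℝ}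
    (hexp : ∀ x ∈ Icc p q, ∀ y ∈ Icc p q, P.lam * |x - y| ≤ |P.f x - P.f y|)
    (hδ : ∀ x ∈ J, ∀ y ∈ J, |x - y| ≤ δ) :
    ∀ x ∈ Icc p q ∩ P.f ⁻¹' J, ∀ y ∈ Icc p q ∩ P.f ⁻¹' J, |x - y| ≤ δ := fun x hx y hy => by
  have h1 := hexp x hx.1 y hy.1
  have h2 := hδ _ hx.2 _ hy.2
  nlinarith [abs_nonneg (x - y), P.lam_gt_one]

/-- Lasota–Yorke inequality for the invariant density on an interval avoiding the critical
value. -/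
theorem IsInvariantDensity.exists_eVariationOn_le (hρ : P.IsInvariantDensity ρ) :
    ∃ L : ℝ≥0, ∀ (δ : ℝ) (J : Set ℝ), J ⊆ Icc 0 1 → J.OrdConnected → P.f P.c ∉ J →
      (∀ x ∈ J, ∀ y ∈ J, |x - y| ≤ δ) →
      eVariationOn ρ J ≤ (ENNReal.ofReal P.lam⁻¹ + L * ENNReal.ofReal δ) *
          (eVariationOn ρ (Icc 0 P.c ∩ P.f ⁻¹' J) + eVariationOn ρ (Icc P.c 1 ∩ P.f ⁻¹' J))
        + L * P.invMeasure ρ J := by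
  obtain ⟨hz0, hz1⟩ := hρ.eq_zero
  have hnn := hρ.2.1
  have hc := P.c_mem
  obtain ⟨L₁, hL₁⟩ := exists_lipschitzOnWith_deriv (by linarith [P.eps_pos, hc.1]) P.smooth₁
    P.lam_pos P.expand₁
  obtain ⟨L₂, hL₂⟩ := exists_lipschitzOnWith_deriv (by linarith [P.eps_pos, hc.2]) P.smooth₂
    P.lam_pos P.expand₂
  refine ⟨max L₁ L₂, fun δ J hJ01 hJ hcJ hδ => ?_⟩
  have hl := P.strictMonoOn_or_strictAntiOn_left
  have hr := P.strictMonoOn_or_strictAntiOn_right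
  set K₁ := Icc 0 P.c ∩ P.f ⁻¹' J with hK₁
  set K₂ := Icc P.c 1 ∩ P.f ⁻¹' J with hK₂
  have hK₁o : K₁.OrdConnected := ordConnected_inter_preimage hl hJ
  have hK₂o : K₂.OrdConnected := ordConnected_inter_preimage hr hJ
  have hcK : ∀ y ∈ P.f ⁻¹' J, y ≠ P.c := fun y hy h => hcJ (h ▸ hy)
  have h1 : eVariationOn (P.weighted ρ) K₁ ≤ (ENNReal.ofReal P.lam⁻¹
      + (max L₁ L₂ : ℝ≥0) * ENNReal.ofReal δ) * eVariationOn ρ K₁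
      + (max L₁ L₂ : ℝ≥0) * volume.withDensity (fun x => ENNReal.ofReal (ρ x)) K₁ := by
    refine eVariationOn_div_abs_le (D := deriv P.f₁) hK₁o hnn P.lam_gt_one
      (fun y hy => P.expand₁ y (P.Icc_left_subset hy.1))
      ((hL₁.mono fun y hy => P.Icc_left_subset hy.1).weaken (le_max_left _ _))
      (abs_sub_le_of_mem_preimage (fun x hx y hy => P.expanding_left hx hy) hδ) fun y hy => ?_
    rcases hy.1.1.eq_or_lt with h | h
    · simp [weighted, ← h, hz0]
    · have hy' : y ∈ Ioo 0 P.c := ⟨h, lt_of_le_of_ne hy.1.2 (hcK y hy.2)⟩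
      rw [weighted, P.deriv_eq_left hy.1 (P.differentiableAt_of_mem_Ioo_left hy')]
  have h2 : eVariationOn (P.weighted ρ) K₂ ≤ (ENNReal.ofReal P.lam⁻¹
      + (max L₁ L₂ : ℝ≥0) * ENNReal.ofReal δ) * eVariationOn ρ K₂
      + (max L₁ L₂ : ℝ≥0) * volume.withDensity (fun x => ENNReal.ofReal (ρ x)) K₂ := by
    refine eVariationOn_div_abs_le (D := deriv P.f₂) hK₂o hnn P.lam_gt_one
      (fun y hy => P.expand₂ y (P.Icc_right_subset hy.1))
      ((hL₂.mono fun y hy => P.Icc_right_subset hy.1).weaken (le_max_right _ _))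
      (abs_sub_le_of_mem_preimage (fun x hx y hy => P.expanding_right hx hy) hδ) fun y hy => ?_
    rcases hy.1.2.eq_or_lt with h | h
    · simp [weighted, h, hz1]
    · have hy' : y ∈ Ioo P.c 1 := ⟨lt_of_le_of_ne hy.1.1 (Ne.symm (hcK y hy.2)), h⟩
      rw [weighted, P.deriv_eq_right hy.1 (P.differentiableAt_of_mem_Ioo_right hy')]
  have hw : ∀ e, ρ e = 0 → P.weighted ρ e = 0 := fun e he => by simp [weighted, he]
  have hμ : P.invMeasure ρ K₁ + P.invMeasure ρ K₂ ≤ P.invMeasure ρ J :=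
    hρ.invMeasure_branch_preimages_le hJ hcJ
  rw [invMeasure_apply hK₁o.measurableSet (inter_subset_left.trans P.Icc_zero_c_subset),
    invMeasure_apply hK₂o.measurableSet (inter_subset_left.trans P.Icc_c_one_subset)] at hμ
  calc eVariationOn ρ J
      ≤ eVariationOn (preimageSum P.f (P.weighted ρ) (Icc 0 P.c)) J
        + eVariationOn (preimageSum P.f (P.weighted ρ) (Icc P.c 1)) J :=
        eVariationOn_add_le_s14 fun x hx => by
          rw [← hρ.2.2.2.2 x (hJ01 hx)]
          exact P.PF_eq_add ρ fun h => hcJ (h ▸ hx)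
    _ ≤ eVariationOn (P.weighted ρ) K₁ + eVariationOn (P.weighted ρ) K₂ :=
        add_le_add
          (eVariationOn_preimageSum_le hc.1.le hl P.continuousOn_left hJ (fun _ => hw 0 hz0)
            fun h => absurd h hcJ)
          (eVariationOn_preimageSum_le hc.2.le hr P.continuousOn_right hJ (fun h => absurd h hcJ)
            fun _ => hw 1 hz1)
    _ ≤ _ := add_le_add h1 h2
    _ = (ENNReal.ofReal P.lam⁻¹ + (max L₁ L₂ : ℝ≥0) * ENNReal.ofReal δ) *
          (eVariationOn ρ K₁ + eVariationOn ρ K₂) + (max L₁ L₂ : ℝ≥0) *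
          (volume.withDensity (fun x => ENNReal.ofReal (ρ x)) K₁
            + volume.withDensity (fun x => ENNReal.ofReal (ρ x)) K₂) := by ring
    _ ≤ _ := by gcongr

end PEUM

namespace PEUM

variable {P : PEUM} {ρ : ℝ → ℝ}

/-- Iterating a Lasota–Yorke inequality on short intervals which avoid the first `n` iterates of
the critical point. -/
theorem IsInvariantDensity.eVariationOn_le_of_forall_iterate_notMem (hρ : P.IsInvariantDensity ρ)
    {N : Measure ℝ} {κ M L : ℝ≥0∞} {δ : ℝ}
    (hN : ∀ J ⊆ Icc 0 1, J.OrdConnected → eVariationOn ρ J ≤ N J) (hM : κ * M + L = M)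
    (hstep : ∀ J ⊆ Icc (0 : ℝ) 1, J.OrdConnected → P.f P.c ∉ J →
      (∀ x ∈ J, ∀ y ∈ J, |x - y| ≤ δ) → eVariationOn ρ J ≤
        κ * (eVariationOn ρ (Icc 0 P.c ∩ P.f ⁻¹' J) + eVariationOn ρ (Icc P.c 1 ∩ P.f ⁻¹' J))
          + L * P.invMeasure ρ J) (n : ℕ) :
    ∀ J ⊆ Icc (0 : ℝ) 1, J.OrdConnected → (∀ x ∈ J, ∀ y ∈ J, |x - y| ≤ δ) →
      (∀ j, 1 ≤ j → j ≤ n → P.f^[j] P.c ∉ J) →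
      eVariationOn ρ J ≤ κ ^ n * N (Icc 0 1 ∩ P.f^[n] ⁻¹' J) + M * P.invMeasure ρ J := by
  induction n with
  | zero =>
    intro J hJ01 hJ _ _
    simpa [inter_eq_right.2 hJ01] using le_add_right (hN J hJ01 hJ)
  | succ n ih =>
    intro J hJ01 hJ hδ hc
    have hcJ : P.f P.c ∉ J := hc 1 le_rfl (by omega)
    set K₁ := Icc 0 P.c ∩ P.f ⁻¹' J with hK₁
    set K₂ := Icc P.c 1 ∩ P.f ⁻¹' J with hK₂
    have hK₁o : K₁.OrdConnected :=
      ordConnected_inter_preimage P.strictMonoOn_or_strictAntiOn_left hJ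
    have hK₂o : K₂.OrdConnected :=
      ordConnected_inter_preimage P.strictMonoOn_or_strictAntiOn_right hJ
    have hcK : ∀ j, 1 ≤ j → j ≤ n → P.f^[j] P.c ∉ P.f ⁻¹' J := fun j _ hj h => by
      refine hc (j + 1) (by omega) (by omega) ?_
      rwa [Function.iterate_succ_apply']
    have h1 := ih K₁ (inter_subset_left.trans P.Icc_zero_c_subset) hK₁o
      (abs_sub_le_of_mem_preimage (fun x hx y hy => P.expanding_left hx hy) hδ)
      fun j hj hjn h => hcK j hj hjn h.2
    have h2 := ih K₂ (inter_subset_left.trans P.Icc_c_one_subset) hK₂o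
      (abs_sub_le_of_mem_preimage (fun x hx y hy => P.expanding_right hx hy) hδ)
      fun j hj hjn h => hcK j hj hjn h.2
    have hNle : N (Icc 0 1 ∩ P.f^[n] ⁻¹' K₁) + N (Icc 0 1 ∩ P.f^[n] ⁻¹' K₂)
        ≤ N (Icc 0 1 ∩ P.f^[n + 1] ⁻¹' J) := by
      rw [← measure_union ?_ ((P.continuousOn.iterate P.mapsTo n).measurableSet_inter_preimage
        measurableSet_Icc hK₂o.measurableSet)]
      · refine measure_mono ?_
        rintro y (hy | hy) <;> refine ⟨hy.1, ?_⟩ <;>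
          simpa only [mem_preimage, Function.iterate_succ_apply'] using hy.2.2
      · refine disjoint_left.2 fun y hy hy' => hcJ ?_
        have h : P.f^[n] y = P.c := le_antisymm hy.2.1.2 hy'.2.1.1
        exact h ▸ hy.2.2
    calc eVariationOn ρ J
        ≤ κ * (eVariationOn ρ K₁ + eVariationOn ρ K₂) + L * P.invMeasure ρ J :=
          hstep J hJ01 hJ hcJ hδ
      _ ≤ κ * ((κ ^ n * N (Icc 0 1 ∩ P.f^[n] ⁻¹' K₁) + M * P.invMeasure ρ K₁)
            + (κ ^ n * N (Icc 0 1 ∩ P.f^[n] ⁻¹' K₂) + M * P.invMeasure ρ K₂))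
            + L * P.invMeasure ρ J := by gcongr
      _ = κ ^ (n + 1) * (N (Icc 0 1 ∩ P.f^[n] ⁻¹' K₁) + N (Icc 0 1 ∩ P.f^[n] ⁻¹' K₂))
            + κ * M * (P.invMeasure ρ K₁ + P.invMeasure ρ K₂) + L * P.invMeasure ρ J := by ring
      _ ≤ κ ^ (n + 1) * N (Icc 0 1 ∩ P.f^[n + 1] ⁻¹' J)
            + κ * M * P.invMeasure ρ J + L * P.invMeasure ρ J := by
          gcongr
          exact hρ.invMeasure_branch_preimages_le hJ hcJ
      _ = _ := by rw [add_assoc, ← add_mul, hM]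

end PEUM

/-- Proposition 4.4. For a mixing PEUM with invariant density `ρ`, there
are `K ≥ 1`, `D ≥ 1` and `ς < 1` such that whenever `|c_j − xb| > ε` for all `1 ≤ j ≤ n`
and `|x − xb| < ε`, one has `|ρ(x) − ρ(xb)| ≤ Kε + Dςⁿ`. -/
theorem density_increment_bound (P : PEUM) (ρ : ℝ → ℝ) (θ : ℝ)
    (hρ : P.IsInvariantDensity ρ) (hmix : P.Mixing ρ θ) :
    ∃ K D ς : ℝ, 1 ≤ K ∧ 1 ≤ D ∧ 0 < ς ∧ ς < 1 ∧
      ∀ ε : ℝ, 0 < ε → ∀ n : ℕ, ∀ xb ∈ Set.Icc (0:ℝ) 1, ∀ x ∈ Set.Icc (0:ℝ) 1,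
        (∀ j : ℕ, 1 ≤ j → j ≤ n → ε < |P.f^[j] P.c - xb|) →
        |x - xb| < ε →
        |ρ x - ρ xb| ≤ K * ε + D * ς ^ n := by
  obtain ⟨L, hL⟩ := hρ.exists_eVariationOn_le
  obtain ⟨N, hN, hNρ⟩ := exists_measure_eVariationOn_le hρ.1
  have hlam : P.lam⁻¹ < 1 := inv_lt_one_of_one_lt₀ P.lam_gt_one
  have hlam0 : 0 < P.lam⁻¹ := inv_pos.2 P.lam_pos
  have hL0 : (0 : ℝ) ≤ L := L.2
  set δ : ℝ := (1 - P.lam⁻¹) / (2 * (L + 1))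
  have hδ : 0 < δ := div_pos (by linarith) (by linarith)
  have hδL : δ * (2 * (L + 1)) = 1 - P.lam⁻¹ := div_mul_cancel₀ _ (by linarith)
  set κ : ℝ := P.lam⁻¹ + L * δ with hκdef
  have hκ0 : 0 < κ := by positivity
  have hκ1 : κ < 1 := by nlinarith
  set M : ℝ := L / (1 - κ)
  have hM0 : 0 ≤ M := div_nonneg hL0 (by linarith)
  have hM : κ * M + L = M := by
    have : M * (1 - κ) = L := div_mul_cancel₀ _ (by linarith)
    linarith
  have hκ : ENNReal.ofReal P.lam⁻¹ + L * ENNReal.ofReal δ = ENNReal.ofReal κ := by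
    rw [hκdef, ENNReal.ofReal_add hlam0.le (by positivity), ENNReal.ofReal_mul hL0,
      ENNReal.ofReal_coe_nnreal]
  have hME : ENNReal.ofReal κ * ENNReal.ofReal M + L = ENNReal.ofReal M := by
    rw [← ENNReal.ofReal_mul hκ0.le, ← ENNReal.ofReal_coe_nnreal,
      ← ENNReal.ofReal_add (by positivity) hL0, hM]
  have hvar := hρ.eVariationOn_le_of_forall_iterate_notMem hNρ hME
    (fun J h1 h2 h3 h4 => hκ ▸ hL δ J h1 h2 h3 h4)
  set V : ℝ := (eVariationOn ρ (Icc 0 1)).toReal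
  have hV0 : 0 ≤ V := ENNReal.toReal_nonneg
  have hosc : ∀ x ∈ Icc (0 : ℝ) 1, ∀ y ∈ Icc (0 : ℝ) 1, |ρ x - ρ y| ≤ V := fun x hx y hy => by
    rw [← Real.dist_eq]
    exact hρ.1.dist_le hx hy
  have hsup : ∀ x ∈ Icc (0 : ℝ) 1, ρ x ≤ V := fun x hx => by
    have h := hosc x hx 0 (by simp)
    rw [hρ.eq_zero.1, sub_zero] at h
    exact (le_abs_self _).trans h
  set D : ℝ := (N (Icc 0 1)).toReal with hDdef
  have hNfin : N (Icc 0 1) ≠ ∞ := isCompact_Icc.measure_lt_top.ne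
  refine ⟨max 1 (M * V + V / δ), max 1 D, κ, le_max_left _ _, le_max_left _ _, hκ0, hκ1,
    fun ε hε n y hy x hx hc hxy => ?_⟩
  have hκn : 0 < κ ^ n := pow_pos hκ0 n
  suffices h : |ρ x - ρ y| ≤ (M * V + V / δ) * ε + D * κ ^ n from
    h.trans (add_le_add (mul_le_mul_of_nonneg_right (le_max_right _ _) hε.le)
      (mul_le_mul_of_nonneg_right (le_max_right _ _) hκn.le))
  have hDn : 0 ≤ D * κ ^ n := mul_nonneg ENNReal.toReal_nonneg hκn.le
  have hMV : 0 ≤ M * V * ε := by positivity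
  rcases le_or_gt δ ε with hδε | hδε
  · have h1 : V ≤ V / δ * ε := by
      rw [div_mul_eq_mul_div, le_div_iff₀ hδ]
      exact mul_le_mul_of_nonneg_left hδε hV0
    linarith [hosc x hx y hy]
  · have hJ01 : uIcc x y ⊆ Icc 0 1 := ordConnected_Icc.uIcc_subset hx hy
    have hclose : ∀ s ∈ uIcc x y, ∀ t ∈ uIcc x y, |s - t| ≤ |x - y| := fun s hs t ht => by
      rw [abs_sub_comm x y]
      exact abs_sub_le_of_uIcc_subset_uIcc (uIcc_subset_uIcc ht hs)
    have hJ := hvar n (uIcc x y) hJ01 ordConnected_uIcc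
      (fun s hs t ht => (hclose s hs t ht).trans (hxy.trans hδε).le)
      (fun j h1 h2 hj => ((hc j h1 h2).trans_le (hclose _ hj _ right_mem_uIcc)).not_gt hxy)
    have hμ : P.invMeasure ρ (uIcc x y) ≤ ENNReal.ofReal (V * ε) := by
      rw [PEUM.invMeasure_apply measurableSet_uIcc hJ01, withDensity_apply _ measurableSet_uIcc]
      calc ∫⁻ t in uIcc x y, ENNReal.ofReal (ρ t)
          ≤ ∫⁻ _ in uIcc x y, ENNReal.ofReal V :=
            setLIntegral_mono measurable_const fun t ht =>
              ENNReal.ofReal_le_ofReal (hsup t (hJ01 ht))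
        _ = ENNReal.ofReal (V * |y - x|) := by
            rw [setLIntegral_const, Real.volume_interval, ENNReal.ofReal_mul hV0]
        _ ≤ _ := ENNReal.ofReal_le_ofReal
            (mul_le_mul_of_nonneg_left (abs_sub_comm x y ▸ hxy.le) hV0)
    have hE : ENNReal.ofReal |ρ x - ρ y| ≤ ENNReal.ofReal (κ ^ n * D + M * (V * ε)) := by
      rw [ENNReal.ofReal_add (by positivity) (by positivity), ENNReal.ofReal_mul hκn.le,
        ENNReal.ofReal_mul hM0, ENNReal.ofReal_pow hκ0.le, hDdef, ENNReal.ofReal_toReal hNfin,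
        ← Real.dist_eq, ← edist_dist]
      calc edist (ρ x) (ρ y) ≤ eVariationOn ρ (uIcc x y) :=
            eVariationOn.edist_le _ left_mem_uIcc right_mem_uIcc
        _ ≤ _ := hJ
        _ ≤ _ := by
            gcongr
            exact inter_subset_left
    have hR := (ENNReal.ofReal_le_ofReal_iff (by positivity)).1 hE
    have hVδ : 0 ≤ V / δ * ε := by positivity
    linarith
end
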